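/- arXiv:1511.07077 — 12 statements merged into one kernel-verified Lean document; each statement's English description precedes it below -/
import Mathlib

section
/- (Schoenberg) A finite distance space (X,d) on X = {1,…,n} is of negative type if and only if (X,√d) is ℓ₂-embeddable, i.e., there exist a dimension t and vectors v_1,…,v_n ∈ ℝᵗ such that d(i,j) = ‖v_i − v_j‖₂² for all i,j ∈ X. -/
/-- A distance space `d` on `Fin n` is of negative type if for all reals
`b₁,…,bₙ` summing to zero, `∑ᵢⱼ bᵢ bⱼ d(i,j) ≤ 0`. -/
def IsNegativeType {n : ℕ} (d : Fin n → Fin n → ℝ) : Prop :=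
  ∀ b : Fin n → ℝ, (∑ i, b i) = 0 → (∑ i, ∑ j, b i * b j * d i j) ≤ 0

/-- Schoenberg: a finite distance space is of negative type iff its square
root is `ℓ₂`-embeddable. -/
theorem negativeType_iff_sqrt_l2_embeddable {n : ℕ} (d : Fin n → Fin n → ℝ)
    (hnonneg : ∀ i j, 0 ≤ d i j)
    (hdiag : ∀ i, d i i = 0)
    (hsymm : ∀ i j, d i j = d j i) :
    IsNegativeType d ↔
      ∃ (t : ℕ) (v : Fin n → EuclideanSpace ℝ (Fin t)),
        ∀ i j, d i j = ‖v i - v j‖ ^ 2 := by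
  constructor
  · intro h
    rcases Nat.eq_zero_or_pos n with hn | hn
    · subst hn
      exact ⟨0, fun _ => 0, fun i => i.elim0⟩
    let k : Fin n := ⟨0, hn⟩
    let G : Matrix (Fin n) (Fin n) ℝ := Matrix.of fun i j => d i k + d j k - d i j
    have hG : G.PosSemidef := by
      refine .of_dotProduct_mulVec_nonneg ?_ ?_
      · ext i j
        simp only [G, Matrix.conjTranspose_apply, Matrix.of_apply, star_trivial]
        rw [hsymm j i]; ring
      · intro x
        have h1 := h (fun i => x i - if i = k then ∑ j, x j else 0) (by simp)
        have h2 : ∑ i, ∑ j, (x i - if i = k then ∑ j, x j else 0) *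
            (x j - if j = k then ∑ j, x j else 0) * d i j
            = ∑ i, ∑ j, x i * x j * d i j - 2 * ((∑ j, x j) * ∑ i, x i * d i k) := by
          generalize ∑ j, x j = S
          have e : ∀ i j, (x i - if i = k then S else 0) * (x j - if j = k then S else 0) * d i j
             = x i * x j * d i j - (if j = k then S * (x i * d i k) else 0)
               - (if i = k then S * (x j * d j k) else 0) := by
            intro i j
            by_cases hi : i = k <;> by_cases hj : j = k
            · subst hi; simp [hj, hdiag]
            · simp [hi, hj, hsymm k j]; ring
            · simp [hi, hj]; ring
            · simp [hi, hj]
          simp only [e, Finset.sum_sub_distrib]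
          rw [Finset.sum_comm (f := fun i j => if i = k then S * (x j * d j k) else 0)]
          simp only [Finset.sum_ite_eq', Finset.mem_univ, if_true, ← Finset.mul_sum]
          ring
        have h3 : star x ⬝ᵥ G.mulVec x = 2 * ((∑ j, x j) * ∑ i, x i * d i k)
            - ∑ i, ∑ j, x i * x j * d i j := by
          have e : star x ⬝ᵥ G.mulVec x = ∑ i, ∑ j, ((x i * d i k) * x j
              + x i * (x j * d j k) - x i * x j * d i j) := by
            simp only [dotProduct, Matrix.mulVec, G, Matrix.of_apply, star_trivial,
              Finset.mul_sum]
            refine Finset.sum_congr rfl fun i _ => Finset.sum_congr rfl fun j _ => ?_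
            ring
          rw [e]
          simp only [Finset.sum_add_distrib, Finset.sum_sub_distrib, ← Finset.mul_sum,
            ← Finset.sum_mul]
          ring
        rw [h3]
        linarith
    obtain ⟨m, A, hA⟩ := Matrix.posSemidef_iff_eq_sum_vecMulVec.mp hG
    have hA' : ∀ i j, d i k + d j k - d i j = ∑ l, A l i * A l j := by
      intro i j
      have := congrFun (congrFun hA i) j
      simpa [G, Matrix.sum_apply, Matrix.vecMulVec_apply] using this
    refine ⟨m, fun i => WithLp.toLp 2 fun l => A l i / √2, fun i j => ?_⟩
    have e : ∀ l, (A l i / √2 - A l j / √2) ^ 2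
        = (A l i * A l i + A l j * A l j - 2 * (A l i * A l j)) / 2 := by
      intro l
      rw [← sub_div, div_pow, Real.sq_sqrt (by norm_num)]
      ring
    rw [EuclideanSpace.real_norm_sq_eq]
    simp only [PiLp.sub_apply, e, ← Finset.sum_div, Finset.sum_sub_distrib,
      Finset.sum_add_distrib, ← Finset.mul_sum, ← hA', hdiag]
    ring
  · rintro ⟨t, v, hv⟩ b hb
    have key : ∑ i, ∑ j, b i * b j * d i j = -2 * inner ℝ (∑ i, b i • v i) (∑ i, b i • v i) := by
      have e : ∀ i j, b i * b j * d i j = (b i * ‖v i‖ ^ 2) * b j + b i * (b j * ‖v j‖ ^ 2)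
          - 2 * (b i * (b j * inner ℝ (v i) (v j))) := by
        intro i j
        rw [hv, norm_sub_sq_real]; ring
      simp only [e, Finset.sum_add_distrib, Finset.sum_sub_distrib, ← Finset.mul_sum,
        ← Finset.sum_mul, hb, sum_inner, inner_sum, real_inner_smul_left, real_inner_smul_right]
      have c : ∑ x, b x * ∑ y, b y * inner ℝ (v y) (v x)
          = ∑ x, b x * ∑ y, b y * inner ℝ (v x) (v y) := by
        refine Finset.sum_congr rfl fun x _ => ?_
        congr 1
        refine Finset.sum_congr rfl fun y _ => ?_
        rw [real_inner_comm]
      rw [c]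
      ring
    rw [key, real_inner_self_eq_norm_sq]
    nlinarith [sq_nonneg ‖∑ i, b i • v i‖]
end

section
/- Let D ∈ ℝ^{n×n} be the matrix of a distance space of negative type on {1,…,n}, let x ∈ ℝⁿ_{≥0}, and let A, B ⊆ {1,…,n} be disjoint sets with ‖x^A‖₁ > 0 and ‖x^B‖₁ > 0. Then ((x^{A∪B})ᵀ D x^{A∪B}) / ‖x^{A∪B}‖₁ ≥ ((x^A)ᵀ D x^A) / ‖x^A‖₁ + ((x^B)ᵀ D x^B) / ‖x^B‖₁. -/
/-- The restriction `x^S` of a vector to a set of coordinates. -/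
def restrict {n : ℕ} (x : Fin n → ℝ) (S : Finset (Fin n)) : Fin n → ℝ :=
  fun i => if i ∈ S then x i else 0

/-- The ℓ₁ norm of a vector. -/
def l1norm {n : ℕ} (x : Fin n → ℝ) : ℝ := ∑ i, |x i|

/-- The dispersion (quadratic form) `xᵀ D x = ∑ᵢⱼ xᵢ xⱼ d(i,j)`. -/
def disp {n : ℕ} (d : Fin n → Fin n → ℝ) (x : Fin n → ℝ) : ℝ :=
  ∑ i, ∑ j, x i * x j * d i j

theorem dispersion_superadditive {n : ℕ} (d : Fin n → Fin n → ℝ)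
    (hnonneg : ∀ i j, 0 ≤ d i j)
    (hdiag : ∀ i, d i i = 0)
    (hsymm : ∀ i j, d i j = d j i)
    (hneg : IsNegativeType d)
    (x : Fin n → ℝ) (hx : ∀ i, 0 ≤ x i)
    (A B : Finset (Fin n)) (hAB : Disjoint A B)
    (hA : 0 < l1norm (restrict x A)) (hB : 0 < l1norm (restrict x B)) :
    disp d (restrict x A) / l1norm (restrict x A)
      + disp d (restrict x B) / l1norm (restrict x B)
      ≤ disp d (restrict x (A ∪ B)) / l1norm (restrict x (A ∪ B)) := by
  have habs : ∀ S : Finset (Fin n), l1norm (restrict x S) = ∑ i, restrict x S i := by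
    intro S
    refine Finset.sum_congr rfl fun i _ => abs_of_nonneg ?_
    unfold restrict
    split_ifs
    · exact hx i
    · exact le_rfl
  have hU : ∀ i, restrict x (A ∪ B) i = restrict x A i + restrict x B i := by
    intro i
    unfold restrict
    by_cases h1 : i ∈ A
    · have h2 : i ∉ B := Finset.disjoint_left.mp hAB h1
      simp [h1, h2]
    · simp [h1]
  have hl : l1norm (restrict x (A ∪ B)) = l1norm (restrict x A) + l1norm (restrict x B) := by
    rw [habs, habs, habs, ← Finset.sum_add_distrib]
    exact Finset.sum_congr rfl fun i _ => hU i
  have hq : ∀ (u v : Fin n → ℝ) (s t : ℝ), ∑ i, ∑ j, (s * u i + t * v i) * (s * u j + t * v j) * d i j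
      = s ^ 2 * disp d u + t ^ 2 * disp d v + s * t * ∑ i, ∑ j, (u i * v j + v i * u j) * d i j := by
    intro u v s t
    simp only [disp, Finset.mul_sum, ← Finset.sum_add_distrib]
    exact Finset.sum_congr rfl fun i _ => Finset.sum_congr rfl fun j _ => by ring
  have h1 := hq (restrict x A) (restrict x B) 1 1
  have h2 := hq (restrict x A) (restrict x B) (l1norm (restrict x B)) (-l1norm (restrict x A))
  have h3 := hneg (fun i => l1norm (restrict x B) * restrict x A i
      + (-l1norm (restrict x A)) * restrict x B i) (by
    rw [Finset.sum_add_distrib, ← Finset.mul_sum, ← Finset.mul_sum, ← habs, ← habs]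
    ring)
  have h4 : disp d (restrict x (A ∪ B)) = ∑ i, ∑ j,
      (1 * restrict x A i + 1 * restrict x B i) * (1 * restrict x A j + 1 * restrict x B j) * d i j := by
    simp only [disp, hU, one_mul]
  rw [h4, h1, hl]
  rw [h2] at h3
  generalize l1norm (restrict x A) = a at *
  generalize l1norm (restrict x B) = b at *
  rw [div_add_div _ _ hA.ne' hB.ne', div_le_div_iff₀ (by positivity) (by positivity)]
  linarith
end

section
/- Let D ∈ ℝ^{n×n} be the matrix of a distance space of negative type on {1,…,n}, let x ∈ ℝⁿ_{≥0}, and let A, B ⊆ {1,…,n} be disjoint sets with ‖x^A‖₁ > 0 and ‖x^B‖₁ > 0. Then 2 (x^A)ᵀ D x^B ≥ (‖x^B‖₁ / ‖x^A‖₁) (x^A)ᵀ D x^A + (‖x^A‖₁ / ‖x^B‖₁) (x^B)ᵀ D x^B. -/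
/-- The bilinear form `yᵀ D z = ∑ᵢⱼ yᵢ zⱼ d(i,j)`. -/
def bil {n : ℕ} (d : Fin n → Fin n → ℝ) (y z : Fin n → ℝ) : ℝ :=
  ∑ i, ∑ j, y i * z j * d i j

theorem cross_term_lower_bound {n : ℕ} (d : Fin n → Fin n → ℝ)
    (hnonneg : ∀ i j, 0 ≤ d i j)
    (hdiag : ∀ i, d i i = 0)
    (hsymm : ∀ i j, d i j = d j i)
    (hneg : IsNegativeType d)
    (x : Fin n → ℝ) (hx : ∀ i, 0 ≤ x i)
    (A B : Finset (Fin n)) (hAB : Disjoint A B)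
    (hA : 0 < l1norm (restrict x A)) (hB : 0 < l1norm (restrict x B)) :
    (l1norm (restrict x B) / l1norm (restrict x A))
        * bil d (restrict x A) (restrict x A)
      + (l1norm (restrict x A) / l1norm (restrict x B))
        * bil d (restrict x B) (restrict x B)
      ≤ 2 * bil d (restrict x A) (restrict x B) := by
  have habs : ∀ S : Finset (Fin n), l1norm (restrict x S) = ∑ i, restrict x S i := by
    intro S
    unfold l1norm
    refine Finset.sum_congr rfl fun i _ => abs_of_nonneg ?_
    unfold restrict
    split_ifs
    · exact hx i
    · exact le_refl 0
  have ha := habs A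
  have hb := habs B
  generalize restrict x A = u at *
  generalize restrict x B = v at *
  generalize l1norm u = a at *
  generalize l1norm v = b at *
  have h := hneg (fun i => b * u i - a * v i) (by
    rw [Finset.sum_sub_distrib, ← Finset.mul_sum, ← Finset.mul_sum, ← ha, ← hb]
    ring)
  have hs : bil d v u = bil d u v := by
    unfold bil
    rw [Finset.sum_comm]
    refine Finset.sum_congr rfl fun i _ => Finset.sum_congr rfl fun j _ => ?_
    rw [hsymm j i]
    ring
  have he : (∑ i, ∑ j, (b * u i - a * v i) * (b * u j - a * v j) * d i j)
      = b ^ 2 * bil d u u - a * b * bil d u v - a * b * bil d v u + a ^ 2 * bil d v v := by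
    unfold bil
    simp only [Finset.mul_sum, ← Finset.sum_sub_distrib, ← Finset.sum_add_distrib]
    refine Finset.sum_congr rfl fun i _ => Finset.sum_congr rfl fun j _ => ?_
    ring
  have h2 : b ^ 2 * bil d u u - a * b * bil d u v - a * b * bil d v u + a ^ 2 * bil d v v ≤ 0 :=
    he ▸ h
  rw [hs] at h2
  have hab : 0 < a * b := mul_pos hA hB
  have e : b / a * bil d u u + a / b * bil d v v
      = (b ^ 2 * bil d u u + a ^ 2 * bil d v v) / (a * b) := by
    have := hA.ne'
    have := hB.ne'
    field_simp
  rw [e, div_le_iff₀ hab]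
  linarith
end

section
/- Let D ∈ ℝ^{n×n} be the matrix of a distance space of negative type on {1,…,n}, let x ∈ ℝⁿ_{≥0} with ‖x‖₁ > 0, and let R_1,…,R_p be a partition of {1,…,n} into disjoint sets, each with ‖x^{R_l}‖₁ > 0. Then (xᵀ D x) / ‖x‖₁ ≥ ∑_{l=1}^p ((x^{R_l})ᵀ D x^{R_l}) / ‖x^{R_l}‖₁. -/
theorem key_ineq_aux {n : ℕ} (d : Fin n → Fin n → ℝ)
    (hsymm : ∀ i j, d i j = d j i) (hneg : IsNegativeType d)
    (x y : Fin n → ℝ) (N r : ℝ) (hN : 0 < N) (hr : 0 < r)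
    (hxN : ∑ i, x i = N) (hyr : ∑ i, y i = r) :
    disp d y / r ≤ 2 / N * (∑ i, ∑ j, y i * x j * d i j) - r * (disp d x / N ^ 2) := by
  have h := hneg (fun i => y i / r - x i / N) (by
    rw [Finset.sum_sub_distrib, ← Finset.sum_div, ← Finset.sum_div, hxN, hyr,
      div_self hr.ne', div_self hN.ne', sub_self])
  have hsw : ∑ i, ∑ j, x i * y j * d i j = ∑ i, ∑ j, y i * x j * d i j := by
    rw [Finset.sum_comm]
    refine Finset.sum_congr rfl fun i _ => Finset.sum_congr rfl fun j _ => ?_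
    rw [hsymm j i]; ring
  have e : ∑ i, ∑ j, (y i / r - x i / N) * (y j / r - x j / N) * d i j
      = 1 / r ^ 2 * disp d y - 1 / (r * N) * (∑ i, ∑ j, y i * x j * d i j)
        - 1 / (r * N) * (∑ i, ∑ j, x i * y j * d i j) + 1 / N ^ 2 * disp d x := by
    unfold disp
    simp only [Finset.mul_sum, ← Finset.sum_sub_distrib, ← Finset.sum_add_distrib]
    refine Finset.sum_congr rfl fun i _ => Finset.sum_congr rfl fun j _ => ?_
    field_simp
    ring
  rw [e, hsw] at h
  have h2 := mul_nonpos_of_nonneg_of_nonpos hr.le h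
  have e2 : r * (1 / r ^ 2 * disp d y - 1 / (r * N) * (∑ i, ∑ j, y i * x j * d i j)
        - 1 / (r * N) * (∑ i, ∑ j, y i * x j * d i j) + 1 / N ^ 2 * disp d x)
      = disp d y / r - (2 / N * (∑ i, ∑ j, y i * x j * d i j) - r * (disp d x / N ^ 2)) := by
    field_simp
    ring
  rw [e2] at h2
  linarith

theorem dispersion_superadditive_partition {n p : ℕ} (d : Fin n → Fin n → ℝ)
    (hnonneg : ∀ i j, 0 ≤ d i j)
    (hdiag : ∀ i, d i i = 0)
    (hsymm : ∀ i j, d i j = d j i)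
    (hneg : IsNegativeType d)
    (x : Fin n → ℝ) (hx : ∀ i, 0 ≤ x i) (hxpos : 0 < l1norm x)
    (R : Fin p → Finset (Fin n))
    (hdisj : ∀ l l', l ≠ l' → Disjoint (R l) (R l'))
    (hcover : (Finset.univ : Finset (Fin n)) = Finset.univ.biUnion R)
    (hRpos : ∀ l, 0 < l1norm (restrict x (R l))) :
    (∑ l, disp d (restrict x (R l)) / l1norm (restrict x (R l)))
      ≤ disp d x / l1norm x := by
  have hN : ∑ i, x i = l1norm x :=
    Finset.sum_congr rfl fun i _ => (abs_of_nonneg (hx i)).symm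
  have hr : ∀ l, ∑ i, restrict x (R l) i = l1norm (restrict x (R l)) := fun l =>
    Finset.sum_congr rfl fun i _ => (abs_of_nonneg (by
      unfold restrict; split_ifs; exacts [hx i, le_rfl])).symm
  have hsum : ∀ i, ∑ l, restrict x (R l) i = x i := by
    intro i
    have hi : i ∈ Finset.univ.biUnion R := hcover ▸ Finset.mem_univ i
    obtain ⟨l, -, hl⟩ := Finset.mem_biUnion.1 hi
    rw [Finset.sum_eq_single l]
    · simp [restrict, hl]
    · intro l' _ hne
      have : i ∉ R l' := fun h => Finset.disjoint_left.1 (hdisj l' l hne) h hl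
      simp [restrict, this]
    · simp
  have hrs : ∑ l, l1norm (restrict x (R l)) = l1norm x := by
    simp only [← hr]
    rw [Finset.sum_comm, ← hN]
    exact Finset.sum_congr rfl fun i _ => hsum i
  have hB : ∑ l, (∑ i, ∑ j, restrict x (R l) i * x j * d i j) = disp d x := by
    rw [Finset.sum_comm]
    refine Finset.sum_congr rfl fun i _ => ?_
    rw [Finset.sum_comm]
    refine Finset.sum_congr rfl fun j _ => ?_
    rw [← Finset.sum_mul, ← Finset.sum_mul, hsum]
  refine (Finset.sum_le_sum fun l _ => key_ineq_aux d hsymm hneg x (restrict x (R l))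
    (l1norm x) _ hxpos (hRpos l) hN (hr l)).trans (le_of_eq ?_)
  rw [Finset.sum_sub_distrib, ← Finset.mul_sum, ← Finset.sum_mul, hB, hrs]
  have := hxpos.ne'
  field_simp
  ring
end

section
/- Let (X,d) be a finite metric space with |X| = n ≥ 2. Then the distance space (X, d^{log₂(n/(n−1))}), whose distance is d(i,j) raised to the power log₂(n/(n−1)), is of negative type. -/
/-- Concavity estimate for powers. -/
theorem rpow_diff_bound {p x y δ : ℝ} (hp0 : 0 < p) (hp1 : p ≤ 1) (hδ : 0 ≤ δ) (hy : δ ≤ y)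
    (hx0 : 0 ≤ x) (hx : x ≤ y + δ) : x ^ p - y ^ p ≤ ((2 : ℝ) ^ p - 1) * δ ^ p := by
  have h1 : x ^ p ≤ (y + δ) ^ p := Real.rpow_le_rpow hx0 hx hp0.le
  have h2 : (2 * δ) ^ p = (2 : ℝ) ^ p * δ ^ p := Real.mul_rpow (by norm_num) hδ
  rcases (hδ.trans hy).eq_or_lt with h0 | h0
  · have hd : δ = 0 := by linarith
    subst hd
    subst h0
    have : x = 0 := by linarith
    subst this
    simp [Real.zero_rpow hp0.ne']
  · have hc := Real.concaveOn_rpow hp0.le hp1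
    have ha0 : 0 ≤ δ / y := by positivity
    have ha1 : 0 ≤ 1 - δ / y := by
      have := (div_le_one h0).2 hy
      linarith
    have hay : δ / y * y = δ := by field_simp
    have mδ : δ ∈ Set.Ici (0 : ℝ) := hδ
    have ms : y + δ ∈ Set.Ici (0 : ℝ) := by
      simp only [Set.mem_Ici]
      linarith
    have c1 := hc.2 ms mδ ha1 ha0 (by ring)
    have c2 := hc.2 ms mδ ha0 ha1 (by ring)
    simp only [smul_eq_mul] at c1 c2
    rw [show (1 - δ / y) * (y + δ) + δ / y * δ = y by linear_combination -hay] at c1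
    rw [show δ / y * (y + δ) + (1 - δ / y) * δ = 2 * δ by linear_combination hay] at c2
    rw [h2] at c2
    nlinarith

/-- Greedy transport decomposition of a vector of zero sum. -/
theorem greedy_decomp {n : ℕ} (d : Fin n → Fin n → ℝ) (N : ℕ) :
    ∀ b : Fin n → ℝ, (∑ i, b i) = 0 → (Finset.univ.filter (fun i => b i ≠ 0)).card ≤ N →
    ∃ (m : ℕ) (T : Fin m → ℝ) (s t : Fin m → Fin n), m ≤ N ∧ (∀ e, 0 ≤ T e) ∧
      (∀ e, 0 < b (s e)) ∧ (∀ e, b (t e) < 0) ∧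
      (∀ F : Fin n → ℝ, ∑ i, b i * F i = ∑ e, T e * (F (s e) - F (t e))) ∧
      (∀ e e', e ≤ e' → d (s e) (t e) ≤ d (s e') (t e) ∧ d (s e) (t e) ≤ d (s e) (t e') ∧
        d (s e) (t e) ≤ d (s e') (t e')) := by
  induction N with
  | zero =>
    intro b _ hc
    have hb : ∀ i, b i = 0 := by
      intro i
      by_contra h
      have : i ∈ Finset.univ.filter (fun i => b i ≠ 0) := by simp [h]
      rw [Finset.card_eq_zero.1 (Nat.le_zero.1 hc)] at this
      simp at this
    exact ⟨0, Fin.elim0, Fin.elim0, Fin.elim0, le_rfl, fun e => e.elim0, fun e => e.elim0,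
      fun e => e.elim0, by simp [hb], fun e => e.elim0⟩
  | succ N ih =>
    intro b hsum hc
    by_cases hb : ∀ i, b i = 0
    · exact ⟨0, Fin.elim0, Fin.elim0, Fin.elim0, Nat.zero_le _, fun e => e.elim0,
        fun e => e.elim0, fun e => e.elim0, by simp [hb], fun e => e.elim0⟩
    push Not at hb
    obtain ⟨i0, hi0⟩ := hb
    obtain ⟨i1, -, hi1⟩ := Finset.exists_pos_of_sum_zero_of_exists_nonzero b hsum
      ⟨i0, Finset.mem_univ _, hi0⟩
    obtain ⟨k1, -, hk1⟩ := Finset.exists_pos_of_sum_zero_of_exists_nonzero (s := Finset.univ)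
      (fun i => - b i) (by simp [hsum]) ⟨i0, Finset.mem_univ _, by simpa using hi0⟩
    obtain ⟨⟨i, k⟩, hik, hmin⟩ := Finset.exists_min_image
      (Finset.univ.filter (fun q : Fin n × Fin n => 0 < b q.1 ∧ b q.2 < 0))
      (fun q => d q.1 q.2) ⟨(i1, k1), by simp [hi1]; linarith⟩
    simp only [Finset.mem_filter, Finset.mem_univ, true_and, Prod.forall] at hik hmin
    obtain ⟨hi, hk⟩ := hik
    have hne : i ≠ k := by
      rintro rfl
      linarith
    set τ := min (b i) (-b k) with hτ
    have hτ0 : 0 < τ := lt_min hi (by linarith)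
    have hτi : τ ≤ b i := min_le_left _ _
    have hτk : τ ≤ -b k := min_le_right _ _
    set b' : Fin n → ℝ := fun j => b j - τ * ((if j = i then 1 else 0) - (if j = k then 1 else 0))
      with hb'
    have hb'i : b' i = b i - τ := by simp [hb', hne]
    have hb'k : b' k = b k + τ := by simp [hb', hne.symm]
    have hb'j : ∀ j, j ≠ i → j ≠ k → b' j = b j := by
      intro j h1 h2
      simp [hb', h1, h2]
    have hF : ∀ F : Fin n → ℝ, ∑ j, b' j * F j = ∑ j, b j * F j - τ * (F i - F k) := by
      intro F
      simp only [hb', sub_mul, Finset.sum_sub_distrib, mul_assoc, ← Finset.mul_sum]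
      simp
    have hpos : ∀ j, 0 < b' j → 0 < b j := by
      intro j hj
      by_cases h1 : j = i
      · rw [h1]; exact hi
      by_cases h2 : j = k
      · rw [h2, hb'k] at hj; linarith
      rwa [hb'j j h1 h2] at hj
    have hneg : ∀ j, b' j < 0 → b j < 0 := by
      intro j hj
      by_cases h1 : j = i
      · rw [h1, hb'i] at hj; linarith
      by_cases h2 : j = k
      · rw [h2]; exact hk
      rwa [hb'j j h1 h2] at hj
    have hcard : (Finset.univ.filter (fun j => b' j ≠ 0)).card <
        (Finset.univ.filter (fun j => b j ≠ 0)).card := by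
      apply Finset.card_lt_card
      rw [Finset.ssubset_iff_of_subset]
      · rcases min_choice (b i) (-b k) with h | h
        · refine ⟨i, by simp [hi.ne'], ?_⟩
          simp only [Finset.mem_filter, Finset.mem_univ, true_and, not_not]
          rw [hb'i, hτ, h, sub_self]
        · refine ⟨k, by simp [hk.ne], ?_⟩
          simp only [Finset.mem_filter, Finset.mem_univ, true_and, not_not]
          rw [hb'k, hτ, h, add_neg_cancel]
      · intro j hj
        simp only [Finset.mem_filter, Finset.mem_univ, true_and] at hj ⊢
        rcases lt_or_gt_of_ne hj with h | h
        · exact (hneg j h).ne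
        · exact (hpos j h).ne'
    have hsum' : ∑ j, b' j = 0 := by
      have := hF (fun _ => 1)
      simpa [hsum] using this
    obtain ⟨m, T, s, t, hm, hT, hs, ht, hFF, hd⟩ := ih b' hsum' (by omega)
    refine ⟨m + 1, Fin.cons τ T, Fin.cons i s, Fin.cons k t, by omega, ?_, ?_, ?_, ?_, ?_⟩
    · intro e
      refine Fin.cases ?_ (fun e => ?_) e
      · simpa using hτ0.le
      · simpa using hT e
    · intro e
      refine Fin.cases ?_ (fun e => ?_) e
      · simpa using hi
      · simpa using hpos _ (hs e)
    · intro e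
      refine Fin.cases ?_ (fun e => ?_) e
      · simpa using hk
      · simpa using hneg _ (ht e)
    · intro F
      rw [Fin.sum_univ_succ]
      simp only [Fin.cons_zero, Fin.cons_succ]
      rw [← hFF F, hF F]
      ring
    · intro e e'
      refine Fin.cases ?_ (fun e => ?_) e <;> refine Fin.cases ?_ (fun e' => ?_) e'
      · intro _
        simp
      · intro _
        simp only [Fin.cons_zero, Fin.cons_succ]
        exact ⟨hmin _ _ ⟨hpos _ (hs e'), hk⟩, hmin _ _ ⟨hi, hneg _ (ht e')⟩,
          hmin _ _ ⟨hpos _ (hs e'), hneg _ (ht e')⟩⟩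
      · intro h
        exact absurd h (by simp)
      · intro h
        simp only [Fin.cons_succ]
        exact hd e e' (Fin.succ_le_succ_iff.1 h)

theorem metric_pow_logb_negativeType {n : ℕ} (hn : 2 ≤ n) (d : Fin n → Fin n → ℝ)
    (hnonneg : ∀ i j, 0 ≤ d i j)
    (hdiag : ∀ i, d i i = 0)
    (hsymm : ∀ i j, d i j = d j i)
    (htri : ∀ i j k, d i j ≤ d i k + d j k) :
    IsNegativeType (fun i j => d i j ^ Real.logb 2 ((n : ℝ) / ((n : ℝ) - 1))) := by
  have hn2 : (2 : ℝ) ≤ n := by exact_mod_cast hn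
  have hn1 : (0 : ℝ) < (n : ℝ) - 1 := by linarith
  set C : ℝ := (n : ℝ) / ((n : ℝ) - 1) with hC
  have hC1 : 1 < C := by rw [hC, lt_div_iff₀ hn1]; linarith
  have hC2 : C ≤ 2 := by rw [hC, div_le_iff₀ hn1]; linarith
  have hCn : (C - 1) * n = C := by rw [hC]; field_simp; ring
  set p : ℝ := Real.logb 2 C with hp
  have hp0 : 0 < p := Real.logb_pos (by norm_num) hC1
  have h2p : (2 : ℝ) ^ p = C := Real.rpow_logb (by norm_num) (by norm_num) (by linarith)
  have hp1 : p ≤ 1 := by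
    rw [hp, Real.logb_le_iff_le_rpow (by norm_num) (by linarith)]
    simpa using hC2
  intro b hb
  obtain ⟨m, T, s, t, hm, hT, -, -, hF, hd⟩ := greedy_decomp d n b hb
    ((Finset.card_filter_le _ _).trans (by simp))
  set r : Fin n → Fin n → ℝ := fun i j => d i j ^ p with hr
  have hr0 : ∀ i j, 0 ≤ r i j := fun i j => Real.rpow_nonneg (hnonneg i j) _
  have hrd : ∀ i, r i i = 0 := fun i => by simp [hr, hdiag, Real.zero_rpow hp0.ne']
  have hrs : ∀ i j, r i j = r j i := fun i j => by simp only [hr]; rw [hsymm]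
  -- kernel on edges
  set K : Fin m → Fin m → ℝ := fun e e' =>
    r (s e) (s e') - r (s e) (t e') - (r (t e) (s e') - r (t e) (t e')) with hK
  have hQ : ∑ i, ∑ j, b i * b j * r i j = ∑ e, ∑ e', T e * T e' * K e e' := by
    have h1 : ∀ i, ∑ j, b i * b j * r i j = b i * ∑ e', T e' * (r i (s e') - r i (t e')) := by
      intro i
      rw [← hF (fun j => r i j), Finset.mul_sum]
      exact Finset.sum_congr rfl fun j _ => by ring
    simp only [h1]
    rw [hF (fun i => ∑ e', T e' * (r i (s e') - r i (t e')))]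
    refine Finset.sum_congr rfl fun e _ => ?_
    rw [← Finset.sum_sub_distrib, Finset.mul_sum]
    refine Finset.sum_congr rfl fun e' _ => ?_
    simp only [hK]
    ring
  have hKs : ∀ e e', K e e' = K e' e := by
    intro e e'
    simp only [hK]
    rw [hrs (s e') (s e), hrs (s e') (t e), hrs (t e') (s e), hrs (t e') (t e)]
    ring
  set w : Fin m → ℝ := fun e => r (s e) (t e) with hw
  have hw0 : ∀ e, 0 ≤ w e := fun e => hr0 _ _
  have hKle : ∀ e e', e ≤ e' →
      K e e' ≤ 2 * (C - 1) * (Real.sqrt (w e) * Real.sqrt (w e')) := by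
    intro e e' hee
    obtain ⟨ha, hb', hc⟩ := hd e e' hee
    have k1 : r (s e) (s e') - r (t e) (s e') ≤ (C - 1) * w e := by
      rw [← h2p]
      refine rpow_diff_bound hp0 hp1 (hnonneg _ _) ?_ (hnonneg _ _) ?_
      · rw [hsymm (t e)]; exact ha
      · have := htri (s e) (s e') (t e)
        rw [hsymm (t e)]; linarith
    have k2 : r (t e) (t e') - r (s e) (t e') ≤ (C - 1) * w e := by
      rw [← h2p]
      refine rpow_diff_bound hp0 hp1 (hnonneg _ _) hb' (hnonneg _ _) ?_
      have := htri (t e) (t e') (s e)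
      rw [hsymm (t e) (s e), hsymm (t e') (s e)] at this
      linarith
    have hww : w e ≤ w e' := Real.rpow_le_rpow (hnonneg _ _) hc hp0.le
    have hsq : w e ≤ Real.sqrt (w e) * Real.sqrt (w e') := by
      calc w e = Real.sqrt (w e) * Real.sqrt (w e) := (Real.mul_self_sqrt (hw0 e)).symm
        _ ≤ _ := mul_le_mul_of_nonneg_left (Real.sqrt_le_sqrt hww) (Real.sqrt_nonneg _)
    have := mul_le_mul_of_nonneg_left hsq (by linarith : 0 ≤ 2 * (C - 1))
    simp only [hK]
    linarith
  have hKle' : ∀ e e', K e e' ≤ 2 * (C - 1) * (Real.sqrt (w e) * Real.sqrt (w e')) := by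
    intro e e'
    rcases le_total e e' with h | h
    · exact hKle e e' h
    · rw [hKs, mul_comm (Real.sqrt (w e))]
      exact hKle e' e h
  set x : Fin m → ℝ := fun e => T e * Real.sqrt (w e) with hx
  have hterm : ∀ e e', T e * T e' * K e e' ≤
      2 * (C - 1) * (x e * x e') - (if e = e' then 2 * C * x e ^ 2 else 0) := by
    intro e e'
    split_ifs with h
    · subst h
      have h1 : K e e = -2 * w e := by
        simp only [hK, hrd, hw]
        rw [hrs (t e) (s e)]; ring
      have h2 : x e ^ 2 = T e ^ 2 * w e := by
        simp only [hx]
        rw [mul_pow, Real.sq_sqrt (hw0 e)]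
      rw [h1, ← sq, ← sq, h2]
      linarith
    · have := mul_le_mul_of_nonneg_left (hKle' e e') (mul_nonneg (hT e) (hT e'))
      simp only [hx]
      linarith
  have hcs : (∑ e, x e) ^ 2 ≤ (m : ℝ) * ∑ e, x e ^ 2 := by
    have := sq_sum_le_card_mul_sum_sq (s := (Finset.univ : Finset (Fin m))) (f := x)
    simpa using this
  have hS : 0 ≤ ∑ e, x e ^ 2 := Finset.sum_nonneg fun e _ => sq_nonneg _
  have hmn : (m : ℝ) ≤ n := by exact_mod_cast hm
  calc ∑ i, ∑ j, b i * b j * r i j = ∑ e, ∑ e', T e * T e' * K e e' := hQ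
    _ ≤ ∑ e, ∑ e', (2 * (C - 1) * (x e * x e') - (if e = e' then 2 * C * x e ^ 2 else 0)) :=
        Finset.sum_le_sum fun e _ => Finset.sum_le_sum fun e' _ => hterm e e'
    _ = 2 * (C - 1) * (∑ e, x e) ^ 2 - 2 * C * ∑ e, x e ^ 2 := by
        simp only [Finset.sum_sub_distrib, ← Finset.mul_sum, Finset.sum_ite_eq, Finset.mem_univ,
          if_true, ← Finset.sum_mul]
        ring
    _ ≤ 2 * (C - 1) * ((n : ℝ) * ∑ e, x e ^ 2) - 2 * C * ∑ e, x e ^ 2 := by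
        have h1 := hcs.trans (mul_le_mul_of_nonneg_right hmn hS)
        have := mul_le_mul_of_nonneg_left h1 (by linarith : 0 ≤ 2 * (C - 1))
        linarith
    _ = 0 := by linear_combination (2 * ∑ e, x e ^ 2) * hCn
end

section
/- Let (X,d) be a finite distance space of negative type and let 0 ≤ α ≤ 1. Then the distance space (X, d^α), whose distance is d(i,j)^α, is also of negative type. -/
/-- `x ↦ x^α` with the convention `0^0 = 0`. -/
noncomputable def powConv (x α : ℝ) : ℝ := if x = 0 then 0 else x ^ α


lemma quad_exp_nonneg {n : ℕ} (K : Matrix (Fin n) (Fin n) ℝ) (hK : K.PosSemidef)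
    (b : Fin n → ℝ) : 0 ≤ ∑ i, ∑ j, b i * b j * Real.exp (K i j) := by
  have hpow : ∀ k : ℕ, (Matrix.of fun i j => (K i j) ^ k : Matrix (Fin n) (Fin n) ℝ).PosSemidef := by
    intro k
    induction k with
    | zero =>
      have h := Matrix.posSemidef_vecMulVec_self_star (fun _ : Fin n => (1 : ℝ))
      convert h using 1
      ext i j
      simp [Matrix.vecMulVec]
    | succ k ih =>
      have h := ih.hadamard hK
      have e : (Matrix.of fun i j => (K i j) ^ (k + 1) : Matrix (Fin n) (Fin n) ℝ)
          = (Matrix.of fun i j => (K i j) ^ k : Matrix (Fin n) (Fin n) ℝ).hadamard K := by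
        ext i j
        simp [Matrix.hadamard, pow_succ]
      rw [e]
      exact h
  have hq : ∀ k : ℕ, 0 ≤ ∑ i, ∑ j, b i * b j * (K i j) ^ k := by
    intro k
    have h := (hpow k).dotProduct_mulVec_nonneg b
    simp only [dotProduct, Matrix.mulVec, Matrix.of_apply, Pi.star_apply, star_trivial,
      Finset.mul_sum] at h
    refine h.trans_eq ?_
    refine Finset.sum_congr rfl fun i _ => Finset.sum_congr rfl fun j _ => by ring
  have hs : HasSum (fun k : ℕ => ∑ i, ∑ j, b i * b j * ((K i j) ^ k / (k.factorial : ℝ)))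
      (∑ i, ∑ j, b i * b j * Real.exp (K i j)) := by
    refine hasSum_sum fun i _ => hasSum_sum fun j _ => HasSum.mul_left _ ?_
    rw [Real.exp_eq_exp_ℝ]
    exact NormedSpace.expSeries_div_hasSum_exp (K i j)
  refine hs.nonneg fun k => ?_
  have : ∑ i, ∑ j, b i * b j * ((K i j) ^ k / (k.factorial : ℝ))
      = (∑ i, ∑ j, b i * b j * (K i j) ^ k) / (k.factorial : ℝ) := by
    simp only [Finset.sum_div, mul_div_assoc]
  rw [this]
  exact div_nonneg (hq k) (by positivity)

lemma base_psd {n : ℕ} (d : Fin n → Fin n → ℝ)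
    (hdiag : ∀ i, d i i = 0) (hsymm : ∀ i j, d i j = d j i)
    (hneg : IsNegativeType d) (p : Fin n) :
    (Matrix.of fun i j => d i p + d j p - d i j : Matrix (Fin n) (Fin n) ℝ).PosSemidef := by
  refine Matrix.PosSemidef.of_dotProduct_mulVec_nonneg ?_ ?_
  · ext i j
    simp [hsymm j i, add_comm]
  · intro x
    have h := hneg (fun i => x i - if i = p then ∑ k, x k else 0) (by simp)
    simp only [dotProduct, Matrix.mulVec, Matrix.of_apply, Pi.star_apply, star_trivial,
      Finset.mul_sum]
    set S := ∑ k, x k with hS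
    have e1 : ∑ i, ∑ j, (x i - if i = p then S else 0) * (x j - if j = p then S else 0) * d i j
        = (∑ i, ∑ j, x i * x j * d i j) - 2 * (S * ∑ i, x i * d i p) := by
      simp only [sub_mul, mul_sub, Finset.sum_sub_distrib, ite_mul, mul_ite, zero_mul, mul_zero,
        Finset.sum_ite_eq', Finset.mem_univ, if_true, hdiag]
      have a1 : ∑ i, x i * S * d i p = S * ∑ i, x i * d i p := by
        rw [Finset.mul_sum]; exact Finset.sum_congr rfl fun i _ => by ring
      have a2 : ∑ i, ∑ j, (if i = p then S * x j * d i j else 0) = S * ∑ i, x i * d i p := by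
        rw [Finset.sum_comm]
        simp only [Finset.sum_ite_eq', Finset.mem_univ, if_true]
        rw [Finset.mul_sum]; exact Finset.sum_congr rfl fun i _ => by rw [hsymm p i]; ring
      have a3 : ∑ i, (if i = p then S * S * d i p else 0) = 0 := by
        simp [hdiag]
      simp only [a1, a2, a3]
      ring
    have e2 : ∑ i, ∑ j, x i * ((d i p + d j p - d i j) * x j)
        = 2 * (S * ∑ i, x i * d i p) - ∑ i, ∑ j, x i * x j * d i j := by
      have a1 : ∑ i, ∑ j, (x i * d i p) * x j = S * ∑ i, x i * d i p := by
        rw [← Finset.sum_mul_sum, mul_comm]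
      have a2 : ∑ i, ∑ j, x i * (x j * d j p) = S * ∑ i, x i * d i p := by
        rw [← Finset.sum_mul_sum]
      have : 2 * (S * ∑ i, x i * d i p) = ∑ i, ∑ j, (x i * d i p) * x j
          + ∑ i, ∑ j, x i * (x j * d j p) := by rw [a1, a2]; ring
      rw [this]
      simp only [← Finset.sum_add_distrib, ← Finset.sum_sub_distrib]
      exact Finset.sum_congr rfl fun i _ => Finset.sum_congr rfl fun j _ => by ring
    rw [e1] at h
    rw [e2]
    linarith

lemma negType_exp {n : ℕ} (d : Fin n → Fin n → ℝ)
    (hdiag : ∀ i, d i i = 0) (hsymm : ∀ i j, d i j = d j i)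
    (hneg : IsNegativeType d) (t : ℝ) (ht : 0 ≤ t) :
    IsNegativeType (fun i j => 1 - Real.exp (-(t * d i j))) := by
  intro b hb
  rcases Nat.eq_zero_or_pos n with rfl | hn
  · simp
  let p : Fin n := ⟨0, hn⟩
  have h := quad_exp_nonneg _ ((base_psd d hdiag hsymm hneg p).smul ht)
    (fun i => b i * Real.exp (-(t * d i p)))
  have e : ∑ i, ∑ j, b i * b j * Real.exp (-(t * d i j)) =
      ∑ i, ∑ j, b i * Real.exp (-(t * d i p)) * (b j * Real.exp (-(t * d j p))) *
        Real.exp ((t • (Matrix.of fun i j => d i p + d j p - d i j :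
          Matrix (Fin n) (Fin n) ℝ)) i j) := by
    refine Finset.sum_congr rfl fun i _ => Finset.sum_congr rfl fun j _ => ?_
    have : -(t * d i j) = -(t * d i p) + -(t * d j p) + t * (d i p + d j p - d i j) := by ring
    rw [this, Real.exp_add, Real.exp_add]
    simp only [Matrix.smul_apply, Matrix.of_apply, smul_eq_mul]
    ring
  rw [← e] at h
  simp only [mul_sub, mul_one, Finset.sum_sub_distrib]
  rw [← Finset.sum_mul_sum, hb]
  linarith

lemma integrable_base (α : ℝ) (h0 : 0 < α) (h1 : α < 1) :
    MeasureTheory.IntegrableOn (fun t : ℝ => (1 - Real.exp (-t)) * t ^ (-1 - α)) (Set.Ioi 0) := by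
  have hc : ContinuousOn (fun t : ℝ => (1 - Real.exp (-t)) * t ^ (-1 - α)) (Set.Ioi 0) := by
    refine ContinuousOn.mul (by fun_prop) ?_
    exact continuousOn_id.rpow_const fun x hx => Or.inl (ne_of_gt hx)
  have hm : MeasureTheory.AEStronglyMeasurable
      (fun t : ℝ => (1 - Real.exp (-t)) * t ^ (-1 - α))
      (MeasureTheory.volume.restrict (Set.Ioi 0)) :=
    hc.aestronglyMeasurable measurableSet_Ioi
  rw [← Set.Ioc_union_Ioi_eq_Ioi (zero_le_one : (0 : ℝ) ≤ 1)] at hm ⊢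
  refine MeasureTheory.IntegrableOn.union ?_ ?_
  · have hi : MeasureTheory.IntegrableOn (fun t : ℝ => t ^ (-α)) (Set.Ioc 0 1) := by
      have := intervalIntegral.intervalIntegrable_rpow' (a := 0) (b := 1) (r := -α) (by linarith)
      exact (intervalIntegrable_iff_integrableOn_Ioc_of_le zero_le_one).1 this
    refine MeasureTheory.Integrable.mono' hi
      (hm.mono_measure (MeasureTheory.Measure.restrict_mono Set.subset_union_left le_rfl)) ?_
    refine (MeasureTheory.ae_restrict_iff' measurableSet_Ioc).2 (.of_forall fun t ht => ?_)
    have ht0 : 0 < t := ht.1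
    have a1 : 0 ≤ 1 - Real.exp (-t) := by
      have := Real.exp_le_one_iff.2 (by linarith : -t ≤ 0); linarith
    have a2 : 1 - Real.exp (-t) ≤ t := by
      have := Real.add_one_le_exp (-t); linarith
    rw [Real.norm_of_nonneg (mul_nonneg a1 (Real.rpow_nonneg ht0.le _))]
    calc _ ≤ t * t ^ (-1 - α) := by gcongr
      _ = t ^ (-α) := by
        rw [← Real.rpow_one_add' ht0.le (by linarith)]; congr 1; ring
  · have hi : MeasureTheory.IntegrableOn (fun t : ℝ => t ^ (-1 - α)) (Set.Ioi 1) :=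
      integrableOn_Ioi_rpow_of_lt (by linarith) one_pos
    refine MeasureTheory.Integrable.mono' hi
      (hm.mono_measure (MeasureTheory.Measure.restrict_mono Set.subset_union_right le_rfl)) ?_
    refine (MeasureTheory.ae_restrict_iff' measurableSet_Ioi).2 (.of_forall fun t ht => ?_)
    have ht0 : (0 : ℝ) < t := lt_trans one_pos ht
    have a1 : 0 ≤ 1 - Real.exp (-t) := by
      have := Real.exp_le_one_iff.2 (by linarith : -t ≤ 0); linarith
    have a2 : 1 - Real.exp (-t) ≤ 1 := by
      have := Real.exp_pos (-t); linarith
    rw [Real.norm_of_nonneg (mul_nonneg a1 (Real.rpow_nonneg ht0.le _))]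
    calc _ ≤ 1 * t ^ (-1 - α) := by gcongr
      _ = _ := one_mul _

lemma scaled (α : ℝ) (x : ℝ) (hx : 0 < x) {t : ℝ} (ht : 0 < t) :
    (1 - Real.exp (-(t * x))) * t ^ (-1 - α) =
      x ^ (1 + α) * ((1 - Real.exp (-(x * t))) * (x * t) ^ (-1 - α)) := by
  have h : x ^ (1 + α) * x ^ (-1 - α) = 1 := by
    rw [← Real.rpow_add hx]; ring_nf; exact Real.rpow_zero x
  rw [Real.mul_rpow hx.le ht.le, mul_comm t x]
  linear_combination (-(1 - Real.exp (-(x * t))) * t ^ (-1 - α)) * h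

lemma integrable_x (α : ℝ) (h0 : 0 < α) (h1 : α < 1) (x : ℝ) (hx : 0 ≤ x) :
    MeasureTheory.IntegrableOn (fun t : ℝ => (1 - Real.exp (-(t * x))) * t ^ (-1 - α))
      (Set.Ioi 0) := by
  rcases hx.eq_or_lt with rfl | hx
  · simp
  have hcg : Set.EqOn (fun t : ℝ => (1 - Real.exp (-(t * x))) * t ^ (-1 - α))
      (fun t : ℝ => x ^ (1 + α) * ((1 - Real.exp (-(x * t))) * (x * t) ^ (-1 - α)))
      (Set.Ioi 0) := fun t ht => scaled α x hx ht
  rw [MeasureTheory.integrableOn_congr_fun hcg measurableSet_Ioi]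
  refine MeasureTheory.Integrable.const_mul ?_ _
  have := (MeasureTheory.integrableOn_Ioi_comp_mul_left_iff
    (fun t : ℝ => (1 - Real.exp (-t)) * t ^ (-1 - α)) 0 hx).2
    (by simpa using integrable_base α h0 h1)
  exact this

lemma integral_x (α : ℝ) (h0 : 0 < α) (x : ℝ) (hx : 0 ≤ x) :
    ∫ t in Set.Ioi (0 : ℝ), (1 - Real.exp (-(t * x))) * t ^ (-1 - α) =
      powConv x α * ∫ t in Set.Ioi (0 : ℝ), (1 - Real.exp (-t)) * t ^ (-1 - α) := by
  rcases hx.eq_or_lt with rfl | hx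
  · simp [powConv]
  rw [MeasureTheory.setIntegral_congr_fun measurableSet_Ioi (fun t ht => scaled α x hx ht),
    MeasureTheory.integral_const_mul,
    MeasureTheory.integral_comp_mul_left_Ioi
      (fun t : ℝ => (1 - Real.exp (-t)) * t ^ (-1 - α)) 0 hx]
  simp only [mul_zero, smul_eq_mul, powConv, hx.ne', if_false]
  rw [Real.rpow_add hx, Real.rpow_one]
  field_simp

lemma const_pos (α : ℝ) (h0 : 0 < α) (h1 : α < 1) :
    0 < ∫ t in Set.Ioi (0 : ℝ), (1 - Real.exp (-t)) * t ^ (-1 - α) := by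
  have hp : ∀ t ∈ Set.Ioi (0 : ℝ), 0 < (1 - Real.exp (-t)) * t ^ (-1 - α) := by
    intro t ht
    have ht0 : (0 : ℝ) < t := ht
    refine mul_pos ?_ (Real.rpow_pos_of_pos ht0 _)
    have := Real.exp_lt_exp.2 (by linarith : -t < 0)
    rw [Real.exp_zero] at this
    linarith
  rw [MeasureTheory.setIntegral_pos_iff_support_of_nonneg_ae
    ((MeasureTheory.ae_restrict_iff' measurableSet_Ioi).2 (.of_forall fun t ht => (hp t ht).le))
    (integrable_base α h0 h1)]
  have hsub : Set.Ioi (0 : ℝ) ⊆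
      Function.support (fun t : ℝ => (1 - Real.exp (-t)) * t ^ (-1 - α)) :=
    fun t ht => (hp t ht).ne'
  rw [Set.inter_eq_right.2 hsub]
  simp

theorem negativeType_pow {n : ℕ} (d : Fin n → Fin n → ℝ)
    (hnonneg : ∀ i j, 0 ≤ d i j)
    (hdiag : ∀ i, d i i = 0)
    (hsymm : ∀ i j, d i j = d j i)
    (hneg : IsNegativeType d)
    (α : ℝ) (hα0 : 0 ≤ α) (hα1 : α ≤ 1) :
    IsNegativeType (fun i j => powConv (d i j) α) := by
  rcases hα1.eq_or_lt with rfl | h1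
  · have : (fun i j => powConv (d i j) 1) = d := by
      ext i j
      by_cases h : d i j = 0 <;> simp [powConv, h]
    rw [this]
    exact hneg
  intro b hb
  rcases hα0.eq_or_lt with rfl | h0
  · have hlim : Filter.Tendsto
        (fun t : ℝ => ∑ i, ∑ j, b i * b j * (1 - Real.exp (-(t * d i j)))) Filter.atTop
        (nhds (∑ i, ∑ j, b i * b j * powConv (d i j) 0)) := by
      refine tendsto_finsetSum _ fun i _ => tendsto_finsetSum _ fun j _ =>
        Filter.Tendsto.const_mul _ ?_
      rcases (hnonneg i j).eq_or_lt with h | h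
      · simp [powConv, ← h]
      · have hE : Filter.Tendsto (fun t : ℝ => Real.exp (-(t * d i j))) Filter.atTop (nhds 0) :=
          Real.tendsto_exp_neg_atTop_nhds_zero.comp (Filter.tendsto_id.atTop_mul_const h)
        simpa [powConv, h.ne'] using hE.const_sub 1
    refine le_of_tendsto hlim ?_
    filter_upwards [Filter.eventually_ge_atTop 0] with t ht
    exact negType_exp d hdiag hsymm hneg t ht b hb
  · set C := ∫ t in Set.Ioi (0 : ℝ), (1 - Real.exp (-t)) * t ^ (-1 - α) with hC
    have hCpos : 0 < C := const_pos α h0 h1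
    have key : (∑ i, ∑ j, b i * b j * powConv (d i j) α) * C =
        ∫ t in Set.Ioi (0 : ℝ), ∑ i, ∑ j,
          b i * b j * ((1 - Real.exp (-(t * d i j))) * t ^ (-1 - α)) := by
      have hi : ∀ i j, MeasureTheory.Integrable (fun t : ℝ =>
          b i * b j * ((1 - Real.exp (-(t * d i j))) * t ^ (-1 - α)))
          (MeasureTheory.volume.restrict (Set.Ioi 0)) := fun i j =>
        MeasureTheory.Integrable.const_mul (integrable_x α h0 h1 _ (hnonneg i j)) _
      rw [MeasureTheory.integral_finsetSum _
        fun i _ => MeasureTheory.integrable_finsetSum _ fun j _ => hi i j, Finset.sum_mul]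
      refine Finset.sum_congr rfl fun i _ => ?_
      rw [MeasureTheory.integral_finsetSum _ fun j _ => hi i j, Finset.sum_mul]
      refine Finset.sum_congr rfl fun j _ => ?_
      rw [MeasureTheory.integral_const_mul, integral_x α h0 _ (hnonneg i j)]
      ring
    have hle : (∑ i, ∑ j, b i * b j * powConv (d i j) α) * C ≤ 0 := by
      rw [key]
      refine MeasureTheory.setIntegral_nonpos measurableSet_Ioi fun t ht => ?_
      have ht0 : (0 : ℝ) < t := ht
      have h := negType_exp d hdiag hsymm hneg t ht0.le b hb
      simp only [← mul_assoc, ← Finset.sum_mul]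
      exact mul_nonpos_of_nonpos_of_nonneg h (Real.rpow_nonneg ht0.le _)
    exact nonpos_of_mul_nonpos_left hle hCpos
end

section
/- Let (X,d) be a finite distance space of negative type and let λ > 0. Then the distance space (X, f∘d) with f(x) = 1 − e^{−λx}, i.e., with distance 1 − e^{−λ d(i,j)}, is also of negative type. -/
theorem posSemidef_of_sum {n : ℕ} (A : Matrix (Fin n) (Fin n) ℝ)
    (hs : ∀ i j, A i j = A j i)
    (h : ∀ x : Fin n → ℝ, 0 ≤ ∑ i, ∑ j, x i * x j * A i j) : A.PosSemidef := by
  refine Matrix.PosSemidef.of_dotProduct_mulVec_nonneg ?_ ?_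
  · ext i j
    simp [hs j i]
  · intro x
    refine (h x).trans_eq ?_
    simp only [dotProduct, Matrix.mulVec, Finset.mul_sum, Pi.star_apply, star_trivial]
    refine Finset.sum_congr rfl fun i _ => Finset.sum_congr rfl fun j _ => ?_
    ring

theorem sum_of_posSemidef {n : ℕ} (A : Matrix (Fin n) (Fin n) ℝ) (hA : A.PosSemidef)
    (x : Fin n → ℝ) : 0 ≤ ∑ i, ∑ j, x i * x j * A i j := by
  refine (hA.dotProduct_mulVec_nonneg x).trans_eq ?_
  simp only [dotProduct, Matrix.mulVec, Finset.mul_sum, Pi.star_apply, star_trivial]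
  refine Finset.sum_congr rfl fun i _ => Finset.sum_congr rfl fun j _ => ?_
  ring

theorem posSemidef_entry_pow {n : ℕ} (A : Matrix (Fin n) (Fin n) ℝ) (hA : A.PosSemidef) (m : ℕ) :
    (Matrix.of fun i j => A i j ^ m : Matrix (Fin n) (Fin n) ℝ).PosSemidef := by
  induction m with
  | zero =>
    refine posSemidef_of_sum _ (by simp) fun x => ?_
    have : ∑ i, ∑ j, x i * x j = (∑ i, x i) ^ 2 := by
      rw [sq, Finset.sum_mul_sum]
    simp [this, sq_nonneg]
  | succ m ih =>
    have := ih.hadamard hA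
    have e : (Matrix.of fun i j => A i j ^ (m + 1) : Matrix (Fin n) (Fin n) ℝ) =
        (Matrix.of fun i j => A i j ^ m : Matrix (Fin n) (Fin n) ℝ).hadamard A := by
      ext i j
      simp [pow_succ]
    rw [e]
    exact this

theorem sum_exp_nonneg {n : ℕ} (A : Matrix (Fin n) (Fin n) ℝ) (hA : A.PosSemidef)
    (x : Fin n → ℝ) : 0 ≤ ∑ i, ∑ j, x i * x j * Real.exp (A i j) := by
  have h : HasSum (fun m : ℕ => ∑ i, ∑ j, x i * x j * (A i j ^ m / (m.factorial : ℝ)))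
      (∑ i, ∑ j, x i * x j * Real.exp (A i j)) := by
    refine hasSum_sum fun i _ => hasSum_sum fun j _ => HasSum.mul_left _ ?_
    rw [Real.exp_eq_exp_ℝ]
    exact NormedSpace.expSeries_div_hasSum_exp (A i j)
  refine h.nonneg fun m => ?_
  have h2 := sum_of_posSemidef _ (posSemidef_entry_pow A hA m) x
  have h3 := div_nonneg h2 (Nat.cast_nonneg (α := ℝ) m.factorial)
  simpa only [Finset.sum_div, mul_div_assoc, Matrix.of_apply] using h3

theorem negativeType_one_sub_exp {n : ℕ} (d : Fin n → Fin n → ℝ)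
    (hnonneg : ∀ i j, 0 ≤ d i j)
    (hdiag : ∀ i, d i i = 0)
    (hsymm : ∀ i j, d i j = d j i)
    (hneg : IsNegativeType d)
    (lam : ℝ) (hlam : 0 < lam) :
    IsNegativeType (fun i j => 1 - Real.exp (-lam * d i j)) := by
  intro b hb
  rcases n with _ | n
  · simp
  have hM : (Matrix.of fun i j => lam * (d i 0 + d j 0 - d i j) :
      Matrix (Fin (n+1)) (Fin (n+1)) ℝ).PosSemidef := by
    refine posSemidef_of_sum _ ?_ fun x => ?_
    · intro i j
      simp only [Matrix.of_apply, hsymm i j]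
      ring
    · have h := hneg (fun i => x i - (if i = 0 then ∑ k, x k else 0)) (by simp)
      have e1 : ∑ i, ∑ j, (x i - (if i = 0 then ∑ k, x k else 0)) *
          (x j - (if j = 0 then ∑ k, x k else 0)) * d i j =
          ∑ i, ∑ j, x i * x j * d i j - 2 * (∑ k, x k) * ∑ i, x i * d i 0 := by
        have : ∀ i j, (x i - (if i = 0 then ∑ k, x k else 0)) *
          (x j - (if j = 0 then ∑ k, x k else 0)) * d i j = x i * x j * d i j
            - (if j = 0 then (∑ k, x k) * (x i * d i j) else 0)
            - (if i = 0 then (∑ k, x k) * (x j * d i j) else 0)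
            + (if i = 0 then (if j = 0 then (∑ k, x k) * (∑ k, x k) * d i j else 0) else 0) := by
          intro i j
          split_ifs <;> ring
        simp only [this, Finset.sum_add_distrib, Finset.sum_sub_distrib]
        rw [Finset.sum_comm (f := fun i j => if i = 0 then (∑ k, x k) * (x j * d i j) else 0)]
        simp only [Finset.sum_ite_eq', Finset.mem_univ, if_true, hsymm 0, ← Finset.mul_sum]
        simp [hdiag]
        ring
      rw [e1] at h
      have e2 : ∑ i, ∑ j, x i * x j * (lam * (d i 0 + d j 0 - d i j)) =
          lam * (2 * (∑ k, x k) * ∑ i, x i * d i 0 - ∑ i, ∑ j, x i * x j * d i j) := by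
        have a1 : ∑ i, ∑ j, x j * (x i * d i 0) = (∑ k, x k) * ∑ i, x i * d i 0 := by
          rw [Finset.sum_mul_sum, Finset.sum_comm]
        have a2 : ∑ i, ∑ j, x i * (x j * d j 0) = (∑ k, x k) * ∑ i, x i * d i 0 := by
          rw [Finset.sum_mul_sum]
        have a3 : 2 * (∑ k, x k) * ∑ i, x i * d i 0 =
          ∑ i, ∑ j, x j * (x i * d i 0) + ∑ i, ∑ j, x i * (x j * d j 0) := by
          rw [a1, a2]; ring
        rw [a3]
        simp only [← Finset.sum_add_distrib, ← Finset.sum_sub_distrib, Finset.mul_sum]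
        refine Finset.sum_congr rfl fun i _ => Finset.sum_congr rfl fun j _ => ?_
        ring
      simp only [Matrix.of_apply]
      rw [e2]
      exact mul_nonneg hlam.le (by linarith)
  have key := sum_exp_nonneg _ hM (fun i => b i * Real.exp (-lam * d i 0))
  have e : ∀ i j, b i * Real.exp (-lam * d i 0) * (b j * Real.exp (-lam * d j 0)) *
      Real.exp (lam * (d i 0 + d j 0 - d i j)) = b i * b j * Real.exp (-lam * d i j) := by
    intro i j
    have : -lam * d i j = -lam * d i 0 + -lam * d j 0 + lam * (d i 0 + d j 0 - d i j) := by ring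
    rw [this, Real.exp_add, Real.exp_add]
    ring
  simp only [Matrix.of_apply, e] at key
  have z : ∑ i, ∑ j, b i * b j = 0 := by
    rw [← Finset.sum_mul_sum, hb, zero_mul]
  simp only [mul_sub, mul_one, Finset.sum_sub_distrib, z]
  linarith
end

section
/- Let (X,d) be a finite distance space of negative type. Then the distance space (X, f∘d) with f(x) = x/(1+x), i.e., with distance d(i,j)/(1+d(i,j)), is also of negative type. -/
lemma psd_of_quad {n : ℕ} (H : Fin n → Fin n → ℝ) (hs : ∀ i j, H i j = H j i)
    (h : ∀ b : Fin n → ℝ, 0 ≤ ∑ i, ∑ j, b i * b j * H i j) :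
    (Matrix.of H).PosSemidef := by
  refine Matrix.PosSemidef.of_dotProduct_mulVec_nonneg ?_ ?_
  · ext i j
    simp [Matrix.conjTranspose_apply, hs i j]
  · intro b
    have := h b
    simp only [dotProduct, Matrix.mulVec, Matrix.of_apply, Finset.mul_sum]
    refine this.trans_eq (Finset.sum_congr rfl fun i _ => Finset.sum_congr rfl fun j _ => ?_)
    simp only [Pi.star_apply, star_trivial]
    ring

lemma quad_of_psd {n : ℕ} (H : Fin n → Fin n → ℝ) (h : (Matrix.of H).PosSemidef)
    (b : Fin n → ℝ) : 0 ≤ ∑ i, ∑ j, b i * b j * H i j := by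
  have := h.dotProduct_mulVec_nonneg b
  simp only [dotProduct, Matrix.mulVec, Matrix.of_apply, Finset.mul_sum] at this
  refine this.trans_eq (Finset.sum_congr rfl fun i _ => Finset.sum_congr rfl fun j _ => ?_)
  simp only [Pi.star_apply, star_trivial]
  ring

lemma quad_pow {n : ℕ} (H : Fin n → Fin n → ℝ) (h : (Matrix.of H).PosSemidef) (k : ℕ) :
    (Matrix.of fun i j => H i j ^ k).PosSemidef := by
  induction k with
  | zero =>
    apply psd_of_quad
    · simp
    · intro b
      have : ∑ i, ∑ j, b i * b j * H i j ^ 0 = (∑ i, b i) * (∑ i, b i) := by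
        simp [Finset.sum_mul_sum]
      rw [this]
      exact mul_self_nonneg _
  | succ k ih =>
    have := ih.hadamard h
    have e : (Matrix.of fun i j => H i j ^ (k + 1)) =
        (Matrix.of fun i j => H i j ^ k).hadamard (Matrix.of H) := by
      ext i j
      simp [pow_succ]
    rw [e]
    exact this

lemma quad_inv {n : ℕ} (H : Fin n → Fin n → ℝ) (h : (Matrix.of H).PosSemidef)
    (h1 : ∀ i j, |H i j| < 1) (b : Fin n → ℝ) :
    0 ≤ ∑ i, ∑ j, b i * b j * (1 - H i j)⁻¹ := by
  have hs : HasSum (fun k : ℕ => ∑ i, ∑ j, b i * b j * H i j ^ k)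
      (∑ i, ∑ j, b i * b j * (1 - H i j)⁻¹) :=
    hasSum_sum fun i _ => hasSum_sum fun j _ =>
      (hasSum_geometric_of_abs_lt_one (h1 i j)).mul_left _
  exact hs.nonneg fun k => quad_of_psd _ (quad_pow H h k) b

theorem negativeType_div_one_add {n : ℕ} (d : Fin n → Fin n → ℝ)
    (hnonneg : ∀ i j, 0 ≤ d i j)
    (hdiag : ∀ i, d i i = 0)
    (hsymm : ∀ i j, d i j = d j i)
    (hneg : IsNegativeType d) :
    IsNegativeType (fun i j => d i j / (1 + d i j)) := by
  intro b hb
  rcases n with _ | n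
  · simp
  have hr : ∀ i, 0 < 1 + d i 0 := fun i => by linarith [hnonneg i 0]
  have hd : ∀ i j, 0 < 1 + d i j := fun i j => by linarith [hnonneg i j]
  -- Gram-type kernel is positive semidefinite
  have hG : ∀ c : Fin (n+1) → ℝ, 0 ≤ ∑ i, ∑ j, c i * c j * (d i 0 + d j 0 - d i j) := by
    intro c
    set s := ∑ i, c i with hs
    have h0 := hneg (fun i => c i - if i = 0 then s else 0) (by
      simp [Finset.sum_sub_distrib, hs])
    have e1 : ∑ i, ∑ j, (c i - if i = 0 then s else 0) * (c j - if j = 0 then s else 0) * d i j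
        = ∑ i, ∑ j, c i * c j * d i j - 2 * s * ∑ i, c i * d i 0 := by
      have : ∀ i j, (c i - if i = 0 then s else 0) * (c j - if j = 0 then s else 0) * d i j
          = c i * c j * d i j - (if j = 0 then s * (c i * d i j) else 0)
            - (if i = 0 then s * (c j * d j i) else 0)
            + (if i = 0 then (if j = 0 then s * s * d i j else 0) else 0) := by
        intro i j
        rw [hsymm j i]
        split_ifs <;> ring
      simp only [this, Finset.sum_add_distrib, Finset.sum_sub_distrib]
      rw [Finset.sum_comm (f := fun i j => if i = 0 then s * (c j * d j i) else 0)]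
      rw [Finset.sum_comm (f := fun i j => if i = 0 then (if j = 0 then s * s * d i j else 0) else 0)]
      simp [hdiag, ← Finset.mul_sum]
      ring
    have e2 : ∑ i, ∑ j, c i * c j * (d i 0 + d j 0 - d i j)
        = 2 * s * ∑ i, c i * d i 0 - ∑ i, ∑ j, c i * c j * d i j := by
      have : ∀ i j, c i * c j * (d i 0 + d j 0 - d i j)
          = (c i * d i 0) * c j + c i * (c j * d j 0) - c i * c j * d i j := by
        intro i j; ring
      simp only [this, Finset.sum_add_distrib, Finset.sum_sub_distrib]
      rw [← Finset.sum_mul_sum, ← Finset.sum_mul_sum]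
      ring
    rw [e2]
    rw [e1] at h0
    linarith
  let H : Fin (n+1) → Fin (n+1) → ℝ := fun i j =>
    (d i 0 + d j 0 - d i j + d i 0 * d j 0) / ((1 + d i 0) * (1 + d j 0))
  have hH1 : ∀ i j, 1 - H i j = (1 + d i j) / ((1 + d i 0) * (1 + d j 0)) := by
    intro i j
    have := (hr i).ne'
    have := (hr j).ne'
    simp only [H]
    field_simp
    ring
  have hHs : ∀ i j, H i j = H j i := by
    intro i j
    simp only [H, hsymm i j]
    ring
  have hHq : ∀ c : Fin (n+1) → ℝ, 0 ≤ ∑ i, ∑ j, c i * c j * H i j := by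
    intro c
    have e : ∑ i, ∑ j, c i * c j * H i j
        = ∑ i, ∑ j, (c i / (1 + d i 0)) * (c j / (1 + d j 0)) * (d i 0 + d j 0 - d i j)
          + (∑ i, c i / (1 + d i 0) * d i 0) * (∑ i, c i / (1 + d i 0) * d i 0) := by
      rw [Finset.sum_mul_sum]
      simp only [← Finset.sum_add_distrib]
      refine Finset.sum_congr rfl fun i _ => Finset.sum_congr rfl fun j _ => ?_
      have := (hr i).ne'
      have := (hr j).ne'
      simp only [H]
      field_simp
    rw [e]
    exact add_nonneg (hG _) (mul_self_nonneg _)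
  have hlt : ∀ i j, H i j < 1 := by
    intro i j
    have : 0 < 1 - H i j := by
      rw [hH1]
      exact div_pos (hd i j) (mul_pos (hr i) (hr j))
    linarith
  have habs : ∀ i j, |H i j| < 1 := by
    intro i j
    refine abs_lt.2 ⟨?_, hlt i j⟩
    have h2 := hHq (fun k => (if k = i then 1 else 0) + (if k = j then 1 else 0))
    have e : ∑ k, ∑ l, ((if k = i then (1:ℝ) else 0) + (if k = j then 1 else 0)) *
        ((if l = i then 1 else 0) + (if l = j then 1 else 0)) * H k l
        = H i i + H j j + 2 * H i j := by
      simp [add_mul, mul_add, Finset.sum_add_distrib, hHs j i]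
      ring
    rw [e] at h2
    linarith [hlt i i, hlt j j]
  have key := quad_inv H (psd_of_quad H hHs hHq) habs (fun i => b i / (1 + d i 0))
  have e : ∑ i, ∑ j, b i * b j * (d i j / (1 + d i j))
      = (∑ i, b i) * (∑ i, b i) -
        ∑ i, ∑ j, (b i / (1 + d i 0)) * (b j / (1 + d j 0)) * (1 - H i j)⁻¹ := by
    rw [Finset.sum_mul_sum]
    simp only [← Finset.sum_sub_distrib]
    refine Finset.sum_congr rfl fun i _ => Finset.sum_congr rfl fun j _ => ?_
    have := (hr i).ne'
    have := (hr j).ne'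
    have := (hd i j).ne'
    rw [hH1]
    field_simp
    ring
  show ∑ i, ∑ j, b i * b j * (d i j / (1 + d i j)) ≤ 0
  rw [e, hb]
  linarith
end

section
/- Let (X,d) be a finite distance space of negative type. Then the distance space (X, f∘d) with f(x) = ln(1+x), i.e., with distance ln(1 + d(i,j)), is also of negative type. -/
/-- The quadratic form of a kernel is nonnegative. -/
def QNonneg {n : ℕ} (A : Fin n → Fin n → ℝ) : Prop :=
  ∀ c : Fin n → ℝ, 0 ≤ ∑ i, ∑ j, c i * c j * A i j

lemma qnonneg_iff {n : ℕ} (A : Fin n → Fin n → ℝ) (hs : ∀ i j, A i j = A j i) :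
    QNonneg A ↔ (Matrix.of A).PosSemidef := by
  have key : ∀ c : Fin n → ℝ, (∑ i, ∑ j, c i * c j * A i j)
      = dotProduct (star c) (Matrix.mulVec (Matrix.of A) c) := by
    intro c
    simp only [dotProduct, Matrix.mulVec, Finset.mul_sum, Matrix.of_apply, Pi.star_apply,
      star_trivial]
    exact Finset.sum_congr rfl fun i _ => Finset.sum_congr rfl fun j _ => by ring
  constructor
  · intro h
    refine Matrix.PosSemidef.of_dotProduct_mulVec_nonneg ?_ ?_
    · ext i j
      simp [hs i j]
    · intro c
      rw [← key]
      exact h c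
  · intro h c
    rw [key]
    exact h.dotProduct_mulVec_nonneg c

lemma qnonneg_pow {n : ℕ} (A : Fin n → Fin n → ℝ) (hs : ∀ i j, A i j = A j i)
    (h : QNonneg A) (m : ℕ) : QNonneg (fun i j => A i j ^ (m + 1)) := by
  induction m with
  | zero => simpa using h
  | succ m ih =>
    rw [qnonneg_iff _ (fun i j => by rw [hs i j])] at ih ⊢
    rw [qnonneg_iff _ hs] at h
    have := ih.hadamard h
    have e : (Matrix.of fun i j => A i j ^ (m + 1 + 1))
        = (Matrix.of fun i j => A i j ^ (m + 1)).hadamard (Matrix.of A) := by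
      ext i j
      simp [pow_succ]
    rw [e]
    exact this

lemma qnonneg_log {n : ℕ} (A : Fin n → Fin n → ℝ) (hs : ∀ i j, A i j = A j i)
    (h : QNonneg A) (hlt : ∀ i j, |A i j| < 1) :
    QNonneg (fun i j => -Real.log (1 - A i j)) := by
  intro c
  have H : HasSum (fun m : ℕ => ∑ i, ∑ j, c i * c j * (A i j ^ (m + 1) / (m + 1)))
      (∑ i, ∑ j, c i * c j * -Real.log (1 - A i j)) :=
    hasSum_sum fun i _ => hasSum_sum fun j _ =>
      (Real.hasSum_pow_div_log_of_abs_lt_one (hlt i j)).mul_left _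
  refine H.nonneg fun m => ?_
  have := qnonneg_pow A hs h m c
  have e : (∑ i, ∑ j, c i * c j * (A i j ^ (m + 1) / ((m : ℝ) + 1)))
      = (∑ i, ∑ j, c i * c j * A i j ^ (m + 1)) / ((m : ℝ) + 1) := by
    simp only [Finset.sum_div, mul_div_assoc]
  rw [e]
  positivity

lemma qnonneg_base {n : ℕ} (d : Fin n → Fin n → ℝ) (hdiag : ∀ i, d i i = 0)
    (hsymm : ∀ i j, d i j = d j i) (hneg : IsNegativeType d) (z : Fin n) :
    QNonneg (fun i j => d i z + d j z - d i j) := by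
  intro c
  set S := ∑ i, c i with hS
  set T := ∑ i, c i * d i z with hT
  have h := hneg (fun i => c i - if i = z then S else 0) (by simp [Finset.sum_sub_distrib, hS])
  have e1 : (∑ i, ∑ j, (c i - if i = z then S else 0) * (c j - if j = z then S else 0) * d i j)
      = (∑ i, ∑ j, c i * c j * d i j) - 2 * S * T := by
    have : ∀ i, (∑ j, (c i - if i = z then S else 0) * (c j - if j = z then S else 0) * d i j)
        = (∑ j, c i * c j * d i j) - S * (c i * d i z)
          - (if i = z then S * T else 0) := by
      intro i
      by_cases hi : i = z
      · subst hi
        simp only [if_true, mul_sub, sub_mul, Finset.sum_sub_distrib, mul_ite, ite_mul, mul_zero,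
          zero_mul, Finset.sum_ite_eq', Finset.mem_univ, hdiag, hT, Finset.mul_sum]
        have : ∑ j, S * c j * d i j = ∑ j, S * (c j * d j i) :=
          Finset.sum_congr rfl fun j _ => by rw [hsymm i j]; ring
        simp [this]
      · simp only [hi, if_false, mul_sub, sub_mul, Finset.sum_sub_distrib, mul_ite, ite_mul,
          mul_zero, zero_mul, Finset.sum_ite_eq', Finset.mem_univ, if_true, sub_zero,
          Finset.sum_const_zero]
        ring
    simp only [this, Finset.sum_sub_distrib, Finset.sum_ite_eq', Finset.mem_univ, if_true,
      ← Finset.mul_sum, ← hT]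
    ring
  have e2 : (∑ i, ∑ j, c i * c j * (d i z + d j z - d i j))
      = 2 * S * T - ∑ i, ∑ j, c i * c j * d i j := by
    have : ∀ i, (∑ j, c i * c j * (d i z + d j z - d i j))
        = S * (c i * d i z) + c i * T - ∑ j, c i * c j * d i j := by
      intro i
      rw [hS, hT, Finset.sum_mul, Finset.mul_sum, ← Finset.sum_add_distrib,
        ← Finset.sum_sub_distrib]
      exact Finset.sum_congr rfl fun j _ => by ring
    simp only [this, Finset.sum_sub_distrib, Finset.sum_add_distrib, ← Finset.mul_sum,
      ← Finset.sum_mul, ← hT, ← hS]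
    ring
  rw [e1] at h
  rw [e2]
  linarith

theorem negativeType_log_one_add {n : ℕ} (d : Fin n → Fin n → ℝ)
    (hnonneg : ∀ i j, 0 ≤ d i j)
    (hdiag : ∀ i, d i i = 0)
    (hsymm : ∀ i j, d i j = d j i)
    (hneg : IsNegativeType d) :
    IsNegativeType (fun i j => Real.log (1 + d i j)) := by
  intro b hb
  rcases Nat.eq_zero_or_pos n with hn | hn
  · subst hn
    simp
  let z : Fin n := ⟨0, hn⟩
  obtain ⟨a, ha⟩ : ∃ a : Fin n → ℝ, a = fun i => d i z := ⟨_, rfl⟩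
  have hk : QNonneg (fun i j => a i + a j - d i j) := by
    subst ha
    exact qnonneg_base d hdiag hsymm hneg z
  have ha0 : ∀ i, 0 < 1 + a i := fun i => by
    have := hnonneg i z
    simp only [ha]
    linarith
  let M : Fin n → Fin n → ℝ := fun i j => (a i * a j + (a i + a j - d i j)) / ((1 + a i) * (1 + a j))
  have hM1 : ∀ i j, 1 - M i j = (1 + d i j) / ((1 + a i) * (1 + a j)) := by
    intro i j
    have h1 := (ha0 i).ne'
    have h2 := (ha0 j).ne'
    simp only [M]
    field_simp
    ring
  have hMs : ∀ i j, M i j = M j i := by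
    intro i j
    simp only [M]
    rw [hsymm i j]
    ring
  have hM : QNonneg M := by
    intro c
    have h := hk (fun i => c i / (1 + a i))
    have e : (∑ i, ∑ j, c i * c j * M i j) = (∑ i, c i / (1 + a i) * a i) ^ 2 +
        ∑ i, ∑ j, c i / (1 + a i) * (c j / (1 + a j)) * (a i + a j - d i j) := by
      rw [sq, Finset.sum_mul_sum, ← Finset.sum_add_distrib]
      refine Finset.sum_congr rfl fun i _ => ?_
      rw [← Finset.sum_add_distrib]
      refine Finset.sum_congr rfl fun j _ => ?_
      have h1 := (ha0 i).ne'
      have h2 := (ha0 j).ne'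
      simp only [M]
      field_simp
    rw [e]
    exact add_nonneg (sq_nonneg _) h
  have hup : ∀ i j, M i j < 1 := by
    intro i j
    have h1 := ha0 i
    have h2 := ha0 j
    have h3 := hnonneg i j
    have : 0 < 1 - M i j := by
      rw [hM1]
      positivity
    linarith
  have hlt : ∀ i j, |M i j| < 1 := by
    intro i j
    rw [abs_lt]
    refine ⟨?_, hup i j⟩
    have h := hM (fun k => (if k = i then 1 else 0) + (if k = j then 1 else 0))
    simp only [add_mul, mul_add, Finset.sum_add_distrib, ite_mul, mul_ite, one_mul, mul_one,
      zero_mul, mul_zero, Finset.sum_ite_eq', Finset.mem_univ, if_true, Finset.sum_const_zero,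
      Finset.sum_ite_irrel] at h
    have h1 := hup i i
    have h2 := hup j j
    have h3 := hMs i j
    linarith
  have hL := qnonneg_log M hMs hM hlt b
  have e : ∀ i j, b i * b j * -Real.log (1 - M i j) =
      (b i * Real.log (1 + a i)) * b j + b i * (b j * Real.log (1 + a j))
        - b i * b j * Real.log (1 + d i j) := by
    intro i j
    have h1 := (ha0 i).ne'
    have h2 := (ha0 j).ne'
    have h3 := hnonneg i j
    rw [hM1, Real.log_div (by linarith) (mul_ne_zero h1 h2), Real.log_mul h1 h2]
    ring
  simp only [e, Finset.sum_sub_distrib, Finset.sum_add_distrib, ← Finset.mul_sum,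
    ← Finset.sum_mul, hb, mul_zero, zero_mul] at hL
  rw [Finset.sum_const_zero] at hL
  linarith
end

section
/- Let U be a finite set and let A_1,…,A_n be nonempty subsets of U. Then the Jaccard distance d(i,j) = 1 − |A_i ∩ A_j| / |A_i ∪ A_j| on {1,…,n} is of negative type. -/
/-- Multiplying by a Gram kernel preserves positive semidefiniteness. -/
lemma psd_mul_gram {n : ℕ} {U : Type*} [Fintype U] (x : U → Fin n → ℝ) (K : Fin n → Fin n → ℝ)
    (hK : ∀ b : Fin n → ℝ, 0 ≤ ∑ i, ∑ j, b i * b j * K i j) (b : Fin n → ℝ) :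
    0 ≤ ∑ i, ∑ j, b i * b j * ((∑ u, x u i * x u j) * K i j) := by
  have h : ∑ i, ∑ j, b i * b j * ((∑ u, x u i * x u j) * K i j)
      = ∑ u, ∑ i, ∑ j, (b i * x u i) * (b j * x u j) * K i j := by
    rw [Finset.sum_comm]
    simp_rw [Finset.sum_mul, Finset.mul_sum]
    rw [Finset.sum_comm]
    conv_rhs => rw [Finset.sum_comm]
    refine Finset.sum_congr rfl fun i _ => ?_
    conv_rhs => rw [Finset.sum_comm]
    refine Finset.sum_congr rfl fun j _ => ?_
    refine Finset.sum_congr rfl fun u _ => ?_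
    ring
  rw [h]
  exact Finset.sum_nonneg fun u _ => hK _

lemma psd_pow_gram {n : ℕ} {U : Type*} [Fintype U] (x : U → Fin n → ℝ) (k : ℕ) :
    ∀ b : Fin n → ℝ, 0 ≤ ∑ i, ∑ j, b i * b j * (∑ u, x u i * x u j) ^ k := by
  induction k with
  | zero =>
    intro b
    simp only [pow_zero, mul_one]
    rw [← Finset.sum_mul_sum]
    exact mul_self_nonneg _
  | succ k ih =>
    intro b
    simp only [pow_succ']
    exact psd_mul_gram x _ ih b

lemma jaccard_psd {n : ℕ} {U : Type*} [Fintype U]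
    [DecidableEq U] (A : Fin n → Finset U) (hA : ∀ i, (A i).Nonempty) (b : Fin n → ℝ) :
    0 ≤ ∑ i, ∑ j, b i * b j * (((A i ∩ A j).card : ℝ) / ((A i ∪ A j).card : ℝ)) := by
  let N : ℝ := Fintype.card U
  let x : U → Fin n → ℝ := fun u i => if u ∈ A i then 1 else 0
  let y : U → Fin n → ℝ := fun u i => if u ∈ A i then 0 else 1
  have hx : ∀ i j, ∑ u, x u i * x u j = ((A i ∩ A j).card : ℝ) := by
    intro i j
    simp only [x, ← ite_and, mul_ite, mul_one, mul_zero, Finset.sum_boole]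
    congr 2
    ext u; simp [and_comm]
  have hy : ∀ i j, ∑ u, y u i * y u j = N - ((A i ∪ A j).card : ℝ) := by
    intro i j
    have h1 : ((A i ∪ A j).card : ℝ) = ∑ u, if u ∈ A i ∪ A j then (1 : ℝ) else 0 := by
      rw [Finset.sum_boole, Finset.filter_mem_eq_inter, Finset.univ_inter]
    have h2 : N = ∑ _u : U, (1 : ℝ) := by simp [N]
    rw [h1, h2, ← Finset.sum_sub_distrib]
    refine Finset.sum_congr rfl fun u _ => ?_
    by_cases h3 : u ∈ A i <;> by_cases h4 : u ∈ A j <;> simp [y, h3, h4]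
  have hpos : ∀ i j, 0 < ((A i ∪ A j).card : ℝ) := by
    intro i j
    exact_mod_cast Finset.card_pos.mpr ((hA i).mono Finset.subset_union_left)
  have hle : ∀ i j, ((A i ∪ A j).card : ℝ) ≤ N := by
    intro i j
    exact Nat.cast_le.mpr (Finset.card_le_univ (A i ∪ A j))
  have hs : ∀ i j, HasSum (fun k : ℕ => b i * b j * ((∑ u, x u i * x u j) *
      ((∑ u, y u i * y u j) ^ k * (N⁻¹) ^ (k + 1))))
      (b i * b j * (((A i ∩ A j).card : ℝ) / ((A i ∪ A j).card : ℝ))) := by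
    intro i j
    have hp := hpos i j
    have hl := hle i j
    have hN : 0 < N := hp.trans_le hl
    refine HasSum.mul_left _ ?_
    rw [hx, hy, div_eq_mul_inv]
    refine HasSum.mul_left _ ?_
    have hg := (hasSum_geometric_of_lt_one (r := (N - ((A i ∪ A j).card : ℝ)) / N)
      (div_nonneg (by linarith) hN.le) (by rw [div_lt_one hN]; linarith)).mul_left N⁻¹
    convert hg using 1
    · funext k
      rw [div_eq_mul_inv, mul_pow, pow_succ]; ring
    · rw [← mul_inv]
      congr 1
      field_simp
      ring
  have hS := hasSum_sum (s := Finset.univ) fun i _ =>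
    hasSum_sum (s := Finset.univ) fun j _ => hs i j
  refine hS.nonneg fun k => ?_
  refine psd_mul_gram x _ (fun c => ?_) b
  have hk := mul_nonneg (psd_pow_gram y k c)
    (pow_nonneg (inv_nonneg.mpr (Nat.cast_nonneg (Fintype.card U) : (0 : ℝ) ≤ N)) (k + 1))
  simp_rw [Finset.sum_mul, mul_assoc] at hk
  simp_rw [mul_assoc]
  exact hk

theorem jaccard_distance_negativeType {n : ℕ} {U : Type*} [Fintype U]
    [DecidableEq U] (A : Fin n → Finset U) (hA : ∀ i, (A i).Nonempty) :
    IsNegativeType (fun i j =>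
      1 - ((A i ∩ A j).card : ℝ) / ((A i ∪ A j).card : ℝ)) := by
  intro b hb
  have h := jaccard_psd A hA b
  have h0 : ∑ i, ∑ j, b i * b j = 0 := by
    rw [← Finset.sum_mul_sum, hb, zero_mul]
  simp only [mul_sub, mul_one, Finset.sum_sub_distrib]
  rw [h0]
  linarith
end

section
/- Let M be a matroid of rank k ≥ 1 on the ground set X = {1,…,n}, let (X,d) be a distance space of negative type with matrix D (D_{ij} = d(i,j)), and let x* be any point of the base polytope of M, i.e., x* ∈ P(M) with ∑_{i=1}^n x*_i = k. Then there exists a basis B of M whose characteristic vector χ^B satisfies (χ^B)ᵀ D χ^B = ∑_{i,j∈B} d(i,j) ≥ (1 − (4 + 2 ln k)/k) · (x*)ᵀ D x*. -/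
/-- A matroid on the ground set `Fin n`, given by its family of
independent sets. -/
structure FinMatroid (n : ℕ) where
  Indep : Finset (Fin n) → Prop
  empty_indep : Indep ∅
  indep_subset : ∀ ⦃A B : Finset (Fin n)⦄, A ⊆ B → Indep B → Indep A
  indep_exchange : ∀ ⦃A B : Finset (Fin n)⦄, Indep A → Indep B →
    B.card < A.card → ∃ e ∈ A \ B, Indep (insert e B)

open Classical in
/-- The rank of a set: the maximum cardinality of an independent subset. -/
noncomputable def FinMatroid.rank {n : ℕ} (M : FinMatroid n)
    (A : Finset (Fin n)) : ℕ :=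
  (A.powerset.filter (fun S => M.Indep S)).sup Finset.card

/-- The matroid polytope membership: `x ≥ 0` and `∑_{i∈A} xᵢ ≤ r(A)` for all `A`. -/
def FinMatroid.memPolytope {n : ℕ} (M : FinMatroid n) (x : Fin n → ℝ) : Prop :=
  (∀ i, 0 ≤ x i) ∧ ∀ A : Finset (Fin n), (∑ i ∈ A, x i) ≤ (M.rank A : ℝ)

/-- A basis is an inclusion-wise maximal independent set. -/
def FinMatroid.IsBasis {n : ℕ} (M : FinMatroid n) (B : Finset (Fin n)) : Prop :=
  M.Indep B ∧ ∀ B' : Finset (Fin n), M.Indep B' → B ⊆ B' → B' = B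

section helpers
variable {n : ℕ}

lemma FinMatroid.card_le_rank (M : FinMatroid n) {I A : Finset (Fin n)} (hI : M.Indep I)
    (h : I ⊆ A) : I.card ≤ M.rank A := by
  classical
  unfold FinMatroid.rank
  exact Finset.le_sup (f := Finset.card) (by simp [hI, h])

lemma FinMatroid.exists_rank (M : FinMatroid n) (A : Finset (Fin n)) :
    ∃ I, M.Indep I ∧ I ⊆ A ∧ I.card = M.rank A := by
  classical
  obtain ⟨I, hI, h⟩ := Finset.exists_mem_eq_sup (A.powerset.filter (fun S => M.Indep S))
    ⟨∅, by simp [M.empty_indep]⟩ Finset.card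
  simp only [Finset.mem_filter, Finset.mem_powerset] at hI
  refine ⟨I, hI.2, hI.1, ?_⟩
  rw [← h]
  unfold FinMatroid.rank
  congr

lemma FinMatroid.extend (M : FinMatroid n) {I A : Finset (Fin n)} (hI : M.Indep I) (h : I ⊆ A) :
    ∃ J, M.Indep J ∧ J ⊆ A ∧ I ⊆ J ∧ J.card = M.rank A := by
  obtain ⟨m, hm⟩ : ∃ m, m = M.rank A - I.card := ⟨_, rfl⟩
  induction m generalizing I with
  | zero =>
    have := M.card_le_rank hI h
    exact ⟨I, hI, h, Finset.Subset.refl _, by omega⟩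
  | succ m ih =>
    obtain ⟨K, hK, hKA, hKc⟩ := M.exists_rank A
    obtain ⟨e, he, hins⟩ := M.indep_exchange hK hI (by omega)
    rw [Finset.mem_sdiff] at he
    have hc := Finset.card_insert_of_notMem he.2
    obtain ⟨J, h1, h2, h3, h4⟩ := ih hins
      (Finset.insert_subset (hKA he.1) h) (by omega)
    exact ⟨J, h1, h2, (Finset.subset_insert _ _).trans h3, h4⟩

lemma FinMatroid.submod (M : FinMatroid n) (A B : Finset (Fin n)) :
    M.rank (A ∪ B) + M.rank (A ∩ B) ≤ M.rank A + M.rank B := by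
  obtain ⟨I, hI, hIA, hIc⟩ := M.exists_rank (A ∩ B)
  obtain ⟨J, hJ, hJA, hIJ, hJc⟩ := M.extend hI
    (hIA.trans (Finset.inter_subset_left.trans Finset.subset_union_left) : I ⊆ A ∪ B)
  have h1 := M.card_le_rank (M.indep_subset (Finset.inter_subset_left : J ∩ A ⊆ J) hJ)
    Finset.inter_subset_right
  have h2 := M.card_le_rank (M.indep_subset (Finset.inter_subset_left : J ∩ B ⊆ J) hJ)
    Finset.inter_subset_right
  have h3 := Finset.card_union_add_card_inter (J ∩ A) (J ∩ B)
  have h4 : (J ∩ A) ∪ (J ∩ B) = J := by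
    rw [← Finset.inter_union_distrib_left]; exact Finset.inter_eq_left.2 hJA
  have h5 : I.card ≤ ((J ∩ A) ∩ (J ∩ B)).card := Finset.card_le_card (by
    intro e he
    have := hIA he
    have := hIJ he
    simp_all)
  rw [h4] at h3
  omega

lemma FinMatroid.rank_le_card (M : FinMatroid n) (A : Finset (Fin n)) : M.rank A ≤ A.card := by
  obtain ⟨I, _, h, hc⟩ := M.exists_rank A
  rw [← hc]; exact Finset.card_le_card h

lemma FinMatroid.isBasis_of_card (M : FinMatroid n) {B : Finset (Fin n)} (hB : M.Indep B)
    (h : M.rank Finset.univ ≤ B.card) : M.IsBasis B := by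
  refine ⟨hB, fun B' hB' hs => ?_⟩
  have := M.card_le_rank hB' (Finset.subset_univ _)
  exact (Finset.eq_of_subset_of_card_le hs (by omega)).symm

lemma FinMatroid.le_one (M : FinMatroid n) {x : Fin n → ℝ} (hx : M.memPolytope x) (i : Fin n) :
    x i ≤ 1 := by
  have h := hx.2 {i}
  have h2 : (M.rank {i} : ℝ) ≤ 1 := by exact_mod_cast (M.rank_le_card {i}).trans (by simp)
  simp at h
  linarith

/-- intersection of tight sets is tight -/
lemma FinMatroid.tight_inter (M : FinMatroid n) {x : Fin n → ℝ} (hx : M.memPolytope x)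
    {A B : Finset (Fin n)} (hA : ∑ i ∈ A, x i = M.rank A) (hB : ∑ i ∈ B, x i = M.rank B) :
    ∑ i ∈ A ∩ B, x i = M.rank (A ∩ B) := by
  have h1 := hx.2 (A ∪ B)
  have h2 := hx.2 (A ∩ B)
  have h3 := Finset.sum_union_inter (s₁ := A) (s₂ := B) (f := x)
  have h4 : (M.rank (A ∪ B) : ℝ) + M.rank (A ∩ B) ≤ M.rank A + M.rank B := by
    exact_mod_cast M.submod A B
  linarith

/-- The direction `e_i - e_j`. -/
def dirVec (i j : Fin n) : Fin n → ℝ := Pi.single i 1 - Pi.single j 1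

lemma sum_dirVec (i j : Fin n) (S : Finset (Fin n)) :
    ∑ p ∈ S, dirVec i j p = (if i ∈ S then 1 else 0) - (if j ∈ S then 1 else 0) := by
  simp [dirVec, Finset.sum_sub_distrib, Pi.single_apply]

/-- A point of the base polytope with a fractional coordinate can be moved both ways. -/
lemma FinMatroid.exists_dir (M : FinMatroid n) {x : Fin n → ℝ} (hx : M.memPolytope x)
    (hsum : ∑ i, x i = M.rank Finset.univ) (p : Fin n) (hp0 : x p ≠ 0) (hp1 : x p ≠ 1) :
    ∃ i j, i ≠ j ∧ ∃ ε : ℝ, 0 < ε ∧ M.memPolytope (x + ε • dirVec i j) ∧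
      M.memPolytope (x - ε • dirVec i j) := by
  classical
  let T : Finset (Finset (Fin n)) := Finset.univ.filter
    (fun A => ∑ i ∈ A, x i = M.rank A ∧ ∃ q ∈ A, x q ≠ 0 ∧ x q ≠ 1)
  obtain ⟨A, hAT, hmin⟩ := Finset.exists_min_image T Finset.card
    ⟨Finset.univ, by simpa [T, hsum] using ⟨p, hp0, hp1⟩⟩
  simp only [T, Finset.mem_filter, Finset.mem_univ, true_and] at hAT hmin
  obtain ⟨hA, i, hiA, hi0, hi1⟩ := hAT
  have hj : ∃ j ∈ A, j ≠ i ∧ x j ≠ 0 ∧ x j ≠ 1 := by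
    by_contra hcon
    push Not at hcon
    have h1 : ∑ q ∈ A.erase i, x q = (((A.erase i).filter (fun q => x q ≠ 0)).card : ℝ) := by
      rw [Finset.card_filter]
      push_cast
      refine Finset.sum_congr rfl fun q hq => ?_
      rw [Finset.mem_erase] at hq
      by_cases h : x q = 0
      · simp [h]
      · simp [hcon q hq.2 hq.1 h]
    have h2 := Finset.add_sum_erase A x hiA
    rw [h1, hA] at h2
    have h0 : 0 < x i := lt_of_le_of_ne (hx.1 i) (Ne.symm hi0)
    have h3 : x i < 1 := lt_of_le_of_ne (M.le_one hx i) hi1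
    generalize ((A.erase i).filter (fun q => x q ≠ 0)).card = c at h2
    have h4 : (c : ℝ) < M.rank A := by linarith
    have h5 : (M.rank A : ℝ) < c + 1 := by linarith
    have h6 : c < M.rank A := by exact_mod_cast h4
    have h7 : M.rank A < c + 1 := by exact_mod_cast h5
    omega
  obtain ⟨j, hjA, hji, hj0, hj1⟩ := hj
  have key : ∀ S : Finset (Fin n), ∑ q ∈ S, x q = M.rank S → (i ∈ S ↔ j ∈ S) := by
    intro S hS
    have ht := M.tight_inter hx hA hS
    have : i ∈ S ∨ j ∈ S → A ⊆ S := by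
      intro hiS
      by_contra hAS
      have hlt : (A ∩ S).card < A.card := Finset.card_lt_card
        ⟨Finset.inter_subset_left, fun h => hAS (h.trans Finset.inter_subset_right)⟩
      have : A.card ≤ (A ∩ S).card := by
        apply hmin _ ⟨ht, ?_⟩
        rcases hiS with h | h
        · exact ⟨i, by simp [hiA, h], hi0, hi1⟩
        · exact ⟨j, by simp [hjA, h], hj0, hj1⟩
      omega
    exact ⟨fun h => this (Or.inl h) hjA, fun h => this (Or.inr h) hiA⟩
  have hev1 : ∀ S : Finset (Fin n), ∀ᶠ ε : ℝ in nhds 0,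
      ∑ q ∈ S, (x + ε • dirVec i j) q ≤ M.rank S := by
    intro S
    have hform : ∀ ε : ℝ, ∑ q ∈ S, (x + ε • dirVec i j) q
        = ∑ q ∈ S, x q + ε * ((if i ∈ S then 1 else 0) - (if j ∈ S then 1 else 0)) := by
      intro ε
      rw [← sum_dirVec, Finset.mul_sum, ← Finset.sum_add_distrib]; rfl
    simp only [hform]
    rcases (hx.2 S).eq_or_lt with h | h
    · have := key S h
      simp [this, h]
    · have hc : ContinuousAt (fun ε : ℝ => ∑ q ∈ S, x q +
          ε * ((if i ∈ S then 1 else 0) - (if j ∈ S then 1 else 0))) 0 := by fun_prop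
      exact (hc.eventually_lt continuousAt_const (by simpa using h)).mono fun _ h => h.le
  have hev2 : ∀ q : Fin n, ∀ᶠ ε : ℝ in nhds 0, 0 ≤ (x + ε • dirVec i j) q := by
    intro q
    by_cases hq : x q = 0
    · have h1 : q ≠ i := by rintro rfl; exact hi0 hq
      have h2 : q ≠ j := by rintro rfl; exact hj0 hq
      simp [dirVec, hq, h1, h2]
    · have hpos : 0 < x q := lt_of_le_of_ne (hx.1 q) (Ne.symm hq)
      have hc : ContinuousAt (fun ε : ℝ => x q + ε * dirVec i j q) 0 := by fun_prop
      exact (continuousAt_const.eventually_lt hc (by simpa using hpos)).mono fun _ h => h.le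
  have hev : ∀ᶠ ε : ℝ in nhds 0, M.memPolytope (x + ε • dirVec i j) := by
    filter_upwards [Filter.eventually_all.2 hev1, Filter.eventually_all.2 hev2] with ε h1 h2
    exact ⟨h2, h1⟩
  obtain ⟨r, hr, hball⟩ := Metric.eventually_nhds_iff.1 hev
  refine ⟨i, j, hji.symm, r / 2, by positivity, hball ?_, ?_⟩
  · rw [Real.dist_eq, sub_zero, abs_of_pos (by positivity)]; linarith
  · have := @hball (-(r / 2)) (by
      rw [Real.dist_eq, sub_zero, abs_neg, abs_of_pos (by positivity)]; linarith)
    rwa [neg_smul, ← sub_eq_add_neg] at this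

/-- The quadratic objective. -/
def quadObj (d : Fin n → Fin n → ℝ) (a x : Fin n → ℝ) : ℝ :=
  ∑ i, ∑ j, x i * x j * d i j + ∑ i, a i * (x i ^ 2 - x i)

lemma quadObj_second_diff (d : Fin n → Fin n → ℝ) (a x u : Fin n → ℝ) :
    quadObj d a (x + u) + quadObj d a (x - u) = 2 * quadObj d a x +
      2 * (∑ i, ∑ j, u i * u j * d i j + ∑ i, a i * u i ^ 2) := by
  have e1 : ∑ i, ∑ j, (x + u) i * (x + u) j * d i j + ∑ i, ∑ j, (x - u) i * (x - u) j * d i j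
      = 2 * ∑ i, ∑ j, x i * x j * d i j + 2 * ∑ i, ∑ j, u i * u j * d i j := by
    simp only [Finset.mul_sum, ← Finset.sum_add_distrib, Pi.add_apply, Pi.sub_apply]
    exact Finset.sum_congr rfl fun i _ => Finset.sum_congr rfl fun j _ => by ring
  have e2 : ∑ i, a i * ((x + u) i ^ 2 - (x + u) i) + ∑ i, a i * ((x - u) i ^ 2 - (x - u) i)
      = 2 * ∑ i, a i * (x i ^ 2 - x i) + 2 * ∑ i, a i * u i ^ 2 := by
    simp only [Finset.mul_sum, ← Finset.sum_add_distrib, Pi.add_apply, Pi.sub_apply]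
    exact Finset.sum_congr rfl fun i _ => by ring
  unfold quadObj
  linarith

lemma dirVec_quad (d : Fin n → Fin n → ℝ) (hdiag : ∀ i, d i i = 0)
    (hsymm : ∀ i j, d i j = d j i) (i j : Fin n) :
    ∑ p, ∑ q, dirVec i j p * dirVec i j q * d p q = - 2 * d i j := by
  have : ∀ p, ∑ q, dirVec i j p * dirVec i j q * d p q = dirVec i j p * (d p i - d p j) := by
    intro p
    simp [dirVec, mul_assoc, ← Finset.mul_sum, sub_mul, Pi.single_apply, Finset.sum_sub_distrib]
  simp only [this]
  simp [dirVec, sub_mul, Pi.single_apply, Finset.sum_sub_distrib, hdiag, hsymm j i]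
  ring

lemma dirVec_lin (a : Fin n → ℝ) {i j : Fin n} (hij : i ≠ j) :
    ∑ p, a p * dirVec i j p ^ 2 = a i + a j := by
  have : ∀ p, a p * dirVec i j p ^ 2 = (if p = i then a p else 0) + (if p = j then a p else 0) := by
    intro p
    by_cases h1 : p = i
    · subst h1; simp [dirVec, hij]
    · by_cases h2 : p = j
      · subst h2; simp [dirVec, h1]
      · simp [dirVec, h1, h2]
  simp [this, Finset.sum_add_distrib]

/-- Pipage rounding lemma. -/
lemma FinMatroid.pipage (M : FinMatroid n) (d : Fin n → Fin n → ℝ) (hdiag : ∀ i, d i i = 0)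
    (hsymm : ∀ i j, d i j = d j i) (a : Fin n → ℝ)
    (ha : ∀ i j, 2 * d i j < a i + a j) (x : Fin n → ℝ) (hx : M.memPolytope x)
    (hsum : ∑ i, x i = M.rank Finset.univ) :
    ∃ B, M.IsBasis B ∧ quadObj d a x ≤ ∑ i ∈ B, ∑ j ∈ B, d i j := by
  classical
  let P : Set (Fin n → ℝ) := {y | M.memPolytope y ∧ ∑ i, y i = M.rank Finset.univ}
  have hclosed : IsClosed P := by
    have : P = (⋂ i, {y | 0 ≤ y i}) ∩ (⋂ A : Finset (Fin n), {y | ∑ i ∈ A, y i ≤ (M.rank A : ℝ)}) ∩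
        {y | ∑ i, y i = (M.rank Finset.univ : ℝ)} := by
      ext y; simp [P, FinMatroid.memPolytope]
    rw [this]
    refine ((isClosed_iInter fun i => isClosed_le (by fun_prop) (by fun_prop)).inter
      (isClosed_iInter fun A => isClosed_le (by fun_prop) (by fun_prop))).inter
      (isClosed_eq (by fun_prop) (by fun_prop))
  have hcomp : IsCompact P := by
    refine (isCompact_Icc (a := (0 : Fin n → ℝ)) (b := 1)).of_isClosed_subset hclosed ?_
    intro y hy
    exact ⟨fun i => hy.1.1 i, fun i => M.le_one hy.1 i⟩
  have hcont : Continuous (quadObj d a) := by unfold quadObj; fun_prop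
  obtain ⟨y, hyP, hmax⟩ := hcomp.exists_isMaxOn ⟨x, hx, hsum⟩ hcont.continuousOn
  have hint : ∀ p, y p = 0 ∨ y p = 1 := by
    by_contra hcon
    push Not at hcon
    obtain ⟨p, hp0, hp1⟩ := hcon
    obtain ⟨i, j, hij, ε, hε, h1, h2⟩ := M.exists_dir hyP.1 hyP.2 p hp0 hp1
    have hs : ∑ q, dirVec i j q = 0 := by simp [sum_dirVec]
    have m1 := hmax (show y + ε • dirVec i j ∈ P from ⟨h1, by
      simp [Finset.sum_add_distrib, ← Finset.mul_sum, hs, hyP.2]⟩)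
    have m2 := hmax (show y - ε • dirVec i j ∈ P from ⟨h2, by
      simp [Finset.sum_sub_distrib, ← Finset.mul_sum, hs, hyP.2]⟩)
    simp only [Set.mem_ofPred_eq] at m1 m2
    have h3 := quadObj_second_diff d a y (ε • dirVec i j)
    have e1 : ∑ p, ∑ q, (ε • dirVec i j) p * (ε • dirVec i j) q * d p q = ε ^ 2 * (-2 * d i j) := by
      rw [← dirVec_quad d hdiag hsymm, Finset.mul_sum]
      refine Finset.sum_congr rfl fun p _ => ?_
      rw [Finset.mul_sum]
      refine Finset.sum_congr rfl fun q _ => ?_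
      simp only [Pi.smul_apply, smul_eq_mul]; ring
    have e2 : ∑ p, a p * (ε • dirVec i j) p ^ 2 = ε ^ 2 * (a i + a j) := by
      rw [← dirVec_lin a hij, Finset.mul_sum]
      refine Finset.sum_congr rfl fun p _ => ?_
      simp only [Pi.smul_apply, smul_eq_mul]; ring
    rw [e1, e2] at h3
    have := mul_pos (pow_pos hε 2) (sub_pos.2 (ha i j))
    linarith
  let B : Finset (Fin n) := Finset.univ.filter (fun i => y i = 1)
  have hyB : ∀ i, y i = if i ∈ B then 1 else 0 := by
    intro i
    rcases hint i with h | h <;> simp [B, h]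
  have hcard : ∀ A : Finset (Fin n), ∑ i ∈ A, y i = ((A ∩ B).card : ℝ) := by
    intro A
    simp [hyB]
  have hBr : B.card ≤ M.rank B := by
    have h := hyP.1.2 B
    rw [hcard, Finset.inter_self] at h
    exact_mod_cast h
  have hBk : B.card = M.rank Finset.univ := by
    have h := hyP.2
    rw [hcard, Finset.univ_inter] at h
    exact_mod_cast h
  obtain ⟨I, hI, hIB, hIc⟩ := M.exists_rank B
  have : I = B := Finset.eq_of_subset_of_card_le hIB (by omega)
  subst this
  refine ⟨_, M.isBasis_of_card hI hBk.ge, (hmax ⟨hx, hsum⟩ : quadObj d a x ≤ _).trans ?_⟩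
  apply le_of_eq
  unfold quadObj
  have z : ∑ i, a i * (y i ^ 2 - y i) = 0 := Finset.sum_eq_zero fun i _ => by
    rcases hint i with h | h <;> simp [h]
  rw [z, add_zero]
  simp [hyB, ← Finset.sum_filter, Finset.sum_ite_mem]

lemma negType_bound (d : Fin n → Fin n → ℝ) (hdiag : ∀ i, d i i = 0)
    (hsymm : ∀ i j, d i j = d j i) (hneg : IsNegativeType d) (p : Fin n → ℝ)
    (hp : ∑ i, p i = 1) (i j : Fin n) :
    d i j / 2 ≤ ∑ q, p q * d i q + ∑ q, p q * d j q - ∑ r, ∑ q, p r * p q * d r q := by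
  let Q := Matrix.toBilin' (Matrix.of d)
  have hQ : ∀ u v, Q u v = ∑ r, ∑ q, u r * v q * d r q := by
    intro u v
    simp only [Q, Matrix.toBilin'_apply, Matrix.of_apply]
    exact Finset.sum_congr rfl fun _ _ => Finset.sum_congr rfl fun _ _ => by ring
  have hQs : ∀ u v, Q u v = Q v u := by
    intro u v
    rw [hQ, hQ, Finset.sum_comm]
    refine Finset.sum_congr rfl fun _ _ => Finset.sum_congr rfl fun _ _ => ?_
    rw [hsymm]; ring
  have hss : ∀ r s, Q (Pi.single r 1) (Pi.single s 1) = d r s := by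
    intro r s; simp [Q]
  have hsp : ∀ r, Q (Pi.single r 1) p = ∑ q, p q * d r q := by
    intro r
    rw [hQ, Finset.sum_eq_single r]
    · simp
    · intro b _ hb; simp [hb]
    · simp
  have h := hneg ((1 / 2 : ℝ) • Pi.single i 1 + (1 / 2 : ℝ) • Pi.single j 1 - p) (by
    simp [Finset.sum_add_distrib, Finset.sum_sub_distrib, ← Finset.mul_sum, hp, Pi.single_apply]
    try norm_num)
  rw [← hQ] at h
  simp only [map_add, map_sub, map_smul, LinearMap.add_apply, LinearMap.sub_apply,
    LinearMap.smul_apply, smul_eq_mul, hss, hQs p (Pi.single _ _), hsp, hdiag, hsymm j i] at h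
  rw [hQ p p] at h
  linarith

end helpers

theorem rounding_basis_exists {n : ℕ} (M : FinMatroid n) (k : ℕ)
    (hk : 1 ≤ k) (hrank : M.rank Finset.univ = k)
    (d : Fin n → Fin n → ℝ)
    (hnonneg : ∀ i j, 0 ≤ d i j)
    (hdiag : ∀ i, d i i = 0)
    (hsymm : ∀ i j, d i j = d j i)
    (hneg : IsNegativeType d)
    (xs : Fin n → ℝ) (hxs : M.memPolytope xs)
    (hsum : (∑ i, xs i) = (k : ℝ)) :
    ∃ B : Finset (Fin n), M.IsBasis B ∧
      (1 - (4 + 2 * Real.log k) / k) * (∑ i, ∑ j, xs i * xs j * d i j)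
        ≤ ∑ i ∈ B, ∑ j ∈ B, d i j := by
  have hk0 : (0 : ℝ) < k := by exact_mod_cast hk
  have hs' : ∑ i, xs i = M.rank Finset.univ := by rw [hsum, hrank]
  set f := ∑ i, ∑ j, xs i * xs j * d i j with hf
  have hf0 : 0 ≤ f := Finset.sum_nonneg fun i _ => Finset.sum_nonneg fun j _ =>
    mul_nonneg (mul_nonneg (hxs.1 i) (hxs.1 j)) (hnonneg i j)
  let w : Fin n → ℝ := fun i => (∑ q, xs q * d i q) / k - f / k ^ 2 / 2
  have hw : ∀ i j, d i j / 2 ≤ w i + w j := by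
    intro i j
    have h := negType_bound d hdiag hsymm hneg (fun q => xs q / k)
      (by rw [← Finset.sum_div, hsum, div_self hk0.ne']) i j
    have e1 : ∀ i, ∑ q, xs q / k * d i q = (∑ q, xs q * d i q) / k := by
      intro i; rw [Finset.sum_div]; exact Finset.sum_congr rfl fun _ _ => by ring
    have e2 : ∑ r, ∑ q, xs r / k * (xs q / k) * d r q = f / k ^ 2 := by
      rw [hf, Finset.sum_div]
      refine Finset.sum_congr rfl fun _ _ => ?_
      rw [Finset.sum_div]
      refine Finset.sum_congr rfl fun _ _ => ?_
      field_simp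
    rw [e1, e1, e2] at h
    simp only [w]
    linarith
  have hw0 : ∀ i, 0 ≤ w i := by
    intro i
    have := hw i i
    rw [hdiag] at this
    linarith
  have hwsum : ∑ i, w i * xs i = f / k / 2 := by
    have : ∑ i, w i * xs i = (∑ i, ∑ q, xs i * xs q * d i q) / k - (∑ i, xs i) * (f / k ^ 2 / 2) := by
      rw [Finset.sum_mul, Finset.sum_div, ← Finset.sum_sub_distrib]
      refine Finset.sum_congr rfl fun i _ => ?_
      simp only [w, sub_mul]
      congr 1
      · rw [div_mul_eq_mul_div, Finset.sum_mul]
        congr 1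
        exact Finset.sum_congr rfl fun _ _ => by ring
      · ring
    rw [this, hsum, ← hf]
    field_simp
    ring
  have hpip : ∀ δ : ℝ, 0 < δ → ∃ B, M.IsBasis B ∧
      f - (2 * f / k + δ * k) ≤ ∑ i ∈ B, ∑ j ∈ B, d i j := by
    intro δ hδ
    obtain ⟨B, hB, h⟩ := M.pipage d hdiag hsymm (fun i => 4 * w i + δ)
      (fun i j => by have := hw i j; linarith) xs hxs hs'
    refine ⟨B, hB, le_trans ?_ h⟩
    unfold quadObj
    rw [← hf, sub_eq_add_neg]
    gcongr
    have : -(2 * f / k + δ * k) = ∑ i, -((4 * w i + δ) * xs i) := by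
      rw [Finset.sum_neg_distrib]
      simp only [add_mul, Finset.sum_add_distrib, mul_assoc, ← Finset.mul_sum, hwsum, hsum]
      ring
    rw [this]
    refine Finset.sum_le_sum fun i _ => ?_
    have h1 := hw0 i
    have : 0 ≤ (4 * w i + δ) * xs i ^ 2 := by positivity
    linarith
  rcases hf0.eq_or_lt with h0 | hpos
  · obtain ⟨B, hB, _⟩ := hpip 1 one_pos
    refine ⟨B, hB, ?_⟩
    rw [← h0, mul_zero]
    exact Finset.sum_nonneg fun i _ => Finset.sum_nonneg fun j _ => hnonneg i j
  · obtain ⟨B, hB, h⟩ := hpip (2 * f / k ^ 2) (by positivity)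
    refine ⟨B, hB, le_trans ?_ h⟩
    have hl : 0 ≤ Real.log k := Real.log_nonneg (by exact_mod_cast hk)
    have e : f - (2 * f / k + 2 * f / k ^ 2 * k) = (1 - 4 / k) * f := by
      field_simp; ring
    rw [e]
    gcongr
    linarith
end

section
/- Let n > k ≥ 1 be integers and let D ∈ ℝ^{n×n} be the matrix with D_{ij} = 1 for i ≠ j and D_{ii} = 0 (a distance space of negative type). Then: (a) every x ∈ {0,1}ⁿ with ∑_{i=1}^n x_i = k satisfies xᵀ D x = k(k−1); (b) the fractional vector x* = (k/n, …, k/n) satisfies ∑_{i=1}^n x*_i = k and (x*)ᵀ D x* = k²(n−1)/n. Consequently the ratio between the optimal integral value and this fractional value is ((k−1)/k)·(n/(n−1)), which tends to 1 − 1/k as n → ∞; hence the integrality gap of the relaxation max{xᵀDx : x ∈ [0,1]ⁿ, ∑ x_i = k} is at least 1 − 1/k in the limit. -/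
/-- The quadratic form of the uniform metric is `(∑ x)² - ∑ x²`. -/
lemma uniform_form {n : ℕ} (D : Fin n → Fin n → ℝ)
    (hD : ∀ i j, D i j = if i = j then 0 else 1) (x : Fin n → ℝ) :
    (∑ i, ∑ j, x i * x j * D i j) = (∑ i, x i) ^ 2 - ∑ i, x i ^ 2 := by
  have h : ∀ i j, x i * x j * D i j = x i * x j - (if i = j then x i * x j else 0) := by
    intro i j
    rw [hD]
    split_ifs <;> simp
  simp_rw [h, Finset.sum_sub_distrib]
  simp [sq, Finset.sum_mul_sum]

theorem integrality_gap {n k : ℕ} (hk : 1 ≤ k) (hn : k < n)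
    (D : Fin n → Fin n → ℝ)
    (hD : ∀ i j, D i j = if i = j then 0 else 1) :
    IsNegativeType D ∧
    -- (a) every 0/1 vector with coordinate sum k has value k(k-1)
    (∀ x : Fin n → ℝ, (∀ i, x i = 0 ∨ x i = 1) → (∑ i, x i) = (k : ℝ) →
      (∑ i, ∑ j, x i * x j * D i j) = (k : ℝ) * ((k : ℝ) - 1)) ∧
    -- (b) the fractional vector (k/n, …, k/n)
    ((∑ _i : Fin n, (k : ℝ) / n) = (k : ℝ) ∧
      (∑ i : Fin n, ∑ j : Fin n, ((k : ℝ) / n) * ((k : ℝ) / n) * D i j)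
        = (k : ℝ) ^ 2 * ((n : ℝ) - 1) / n) ∧
    -- the ratio of optimal integral to fractional value
    ((k : ℝ) * ((k : ℝ) - 1)) / ((k : ℝ) ^ 2 * ((n : ℝ) - 1) / n)
      = (((k : ℝ) - 1) / k) * ((n : ℝ) / ((n : ℝ) - 1)) ∧
    -- the ratio tends to 1 - 1/k as n → ∞
    Filter.Tendsto
      (fun m : ℕ => (((k : ℝ) - 1) / k) * ((m : ℝ) / ((m : ℝ) - 1)))
      Filter.atTop (nhds (1 - 1 / (k : ℝ))) := by
  have hk0 : (k : ℝ) ≠ 0 := by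
    have : k ≠ 0 := by omega
    exact_mod_cast this
  have hn0 : (n : ℝ) ≠ 0 := by
    have : n ≠ 0 := by omega
    exact_mod_cast this
  have hn1 : (n : ℝ) - 1 ≠ 0 := by
    have : n ≠ 1 := by omega
    rw [sub_ne_zero]
    exact_mod_cast this
  refine ⟨?_, ?_, ⟨?_, ?_⟩, ?_, ?_⟩
  · intro b hb
    rw [uniform_form D hD, hb]
    have : 0 ≤ ∑ i, b i ^ 2 := Finset.sum_nonneg fun i _ => sq_nonneg _
    linarith
  · intro x hx hs
    have h2 : ∑ i, x i ^ 2 = ∑ i, x i := by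
      refine Finset.sum_congr rfl fun i _ => ?_
      rcases hx i with h | h <;> simp [h]
    rw [uniform_form D hD, h2, hs]
    ring
  · simp
    field_simp
  · rw [uniform_form D hD (fun _ => (k : ℝ) / n)]
    simp
    field_simp
  · field_simp
  · have h1 : Filter.Tendsto (fun m : ℕ => (m : ℝ) / ((m : ℝ) - 1)) Filter.atTop (nhds 1) := by
      simpa [sub_eq_add_neg] using tendsto_natCast_div_add_atTop (-1 : ℝ)
    have h2 := h1.const_mul (((k : ℝ) - 1) / k)
    have h3 : ((k : ℝ) - 1) / k * 1 = 1 - 1 / (k : ℝ) := by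
      field_simp
    rwa [h3] at h2
end
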